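/- Define the sequence (a_n)_{n≥0} of rationals by a_0 = 0 and, for n ≥ 1, a_n = p − p^{−1} if ⌊log_3 n⌋ is even and a_n = p^{−1} if ⌊log_3 n⌋ is odd (equivalently, for each m ≥ 0, a_n = p − p^{−1} for 3^{2m} ≤ n < 3^{2m+1} and a_n = p^{−1} for 3^{2m+1} ≤ n < 3^{2m+2}; these are consecutive blocks of lengths 2·3^0, 2·3^1, 2·3^2, …). Then a_n ∈ S'_p for all n ≥ 1, and the value α ∈ ℚ_p of the infinite Ruban continued fraction [a_0, a_1, a_2, …] is transcendental over ℚ. -/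

import Mathlib

open Filter Polynomial

/-- `S_p`: rationals `b` with `b·p^k ∈ ℤ` for some `k ≥ 0` and `0 ≤ b < p`. -/
def Sp (p : ℕ) : Set ℚ :=
  {b : ℚ | (∃ k : ℕ, ∃ z : ℤ, (z : ℚ) = b * (p : ℚ) ^ k) ∧ 0 ≤ b ∧ b < (p : ℚ)}

/-- `S'_p`: elements of `S_p` with `|b|_p ≥ p`. -/
def Sp' (p : ℕ) : Set ℚ :=
  {b : ℚ | b ∈ Sp p ∧ (p : ℚ) ≤ padicNorm p b}

/-- Denominators of the convergents, with shifted index: `rubanQ a 0 = q_{-1} = 0`,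
`rubanQ a 1 = q_0 = 1`, and `rubanQ a (n+1) = q_n = a_n q_{n-1} + q_{n-2}`. -/
def rubanQ (a : ℕ → ℚ) : ℕ → ℚ
  | 0 => 0
  | 1 => 1
  | n + 2 => a (n + 1) * rubanQ a (n + 1) + rubanQ a n

/-- Numerators of the convergents, with shifted index: `rubanR a 0 = r_{-1} = 1`,
`rubanR a 1 = r_0 = a_0`, and `rubanR a (n+1) = r_n = a_n r_{n-1} + r_{n-2}`. -/
def rubanR (a : ℕ → ℚ) : ℕ → ℚ
  | 0 => 1
  | 1 => a 0
  | n + 2 => a (n + 1) * rubanR a (n + 1) + rubanR a n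

/-- `α` is the value of the infinite Ruban continued fraction `[a_0, a_1, …]`, i.e. the
limit in `ℚ_p` of the convergents `r_n / q_n`. -/
def IsRubanValue (p : ℕ) [Fact p.Prime] (a : ℕ → ℚ) (α : ℚ_[p]) : Prop :=
  Filter.Tendsto (fun n : ℕ => ((rubanR a (n + 1) / rubanQ a (n + 1) : ℚ) : ℚ_[p]))
    Filter.atTop (nhds α)

/-- A sequence is ultimately periodic if `a_{n+l} = a_n` for all `n ≥ k`,
for some `k ≥ 0`, `l ≥ 1`. -/
def UltimatelyPeriodic (a : ℕ → ℚ) : Prop :=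
  ∃ k l : ℕ, 1 ≤ l ∧ ∀ n, k ≤ n → a (n + l) = a n

namespace RubanMahler

open scoped PowerSeries

/-! ### Power series with coefficients in a subring -/

/-- The power series all of whose coefficients lie in the subring `S`. -/
def coeffSubring {R : Type*} [CommRing R] (S : Subring R) : Subring R⟦X⟧ where
  carrier := {f | ∀ n, PowerSeries.coeff n f ∈ S}
  mul_mem' {f g} hf hg n := by
    rw [PowerSeries.coeff_mul]
    exact S.sum_mem fun i _ => S.mul_mem (hf _) (hg _)
  one_mem' n := by
    rw [PowerSeries.coeff_one]
    split_ifs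
    exacts [S.one_mem, S.zero_mem]
  add_mem' {f g} hf hg n := by
    rw [map_add]
    exact S.add_mem (hf n) (hg n)
  zero_mem' n := by
    rw [map_zero]
    exact S.zero_mem
  neg_mem' {f} hf n := by
    rw [map_neg]
    exact S.neg_mem (hf n)

section CoeffSubring

variable {R : Type*} [CommRing R] {S : Subring R}

theorem C_mem_coeffSubring {r : R} (hr : r ∈ S) : PowerSeries.C r ∈ coeffSubring S := by
  intro n
  rw [PowerSeries.coeff_C]
  split_ifs
  exacts [hr, S.zero_mem]

theorem X_mem_coeffSubring : (PowerSeries.X : R⟦X⟧) ∈ coeffSubring S := by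
  intro n
  rw [PowerSeries.coeff_X]
  split_ifs
  exacts [S.one_mem, S.zero_mem]

theorem mem_coeffSubring_of_X_pow_mul {m : ℕ} {f : R⟦X⟧}
    (h : PowerSeries.X ^ m * f ∈ coeffSubring S) : f ∈ coeffSubring S := by
  intro n
  have := h (n + m)
  rwa [PowerSeries.coeff_X_pow_mul] at this

/-- Division in `R⟦X⟧` by a series whose constant coefficient can be cancelled
modulo membership in `S`. -/
theorem mem_coeffSubring_of_mul_mem {A g : R⟦X⟧} (hA : A ∈ coeffSubring S)
    (h : A * g ∈ coeffSubring S)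
    (hc : ∀ r, PowerSeries.coeff 0 A * r ∈ S → r ∈ S) : g ∈ coeffSubring S := by
  intro n
  induction n using Nat.strong_induction_on with
  | _ n ih =>
    apply hc
    have h1 := h n
    rw [PowerSeries.coeff_mul, Finset.Nat.sum_antidiagonal_eq_sum_range_succ_mk,
      Finset.sum_range_succ'] at h1
    have h2 : ∑ k ∈ Finset.range n, PowerSeries.coeff (k + 1) A *
        PowerSeries.coeff (n - (k + 1)) g ∈ S :=
      S.sum_mem fun k hk => S.mul_mem (hA _) (ih _ (by have := Finset.mem_range.1 hk; omega))
    have h3 := S.sub_mem h1 h2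
    simpa using h3

theorem eval_mem_of_coeff_mem {T : Subring R} {P : R[X]} (hP : ∀ i, P.coeff i ∈ T) {a : R}
    (ha : a ∈ T) : P.eval a ∈ T := by
  rw [eval_eq_sum_range]
  exact T.sum_mem fun i _ => T.mul_mem (hP i) (T.pow_mem ha i)

/-- A version of Eisenstein's theorem: the coefficients of a power series root `f` of a
polynomial `P` lie in any subring which contains the coefficients of `P`, finitely many
coefficients of `f`, and in which one can cancel the leading coefficient of `P'(f)`. -/
theorem mem_coeffSubring_of_root {P : (R⟦X⟧)[X]} (hP : ∀ i, P.coeff i ∈ coeffSubring S)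
    {f : R⟦X⟧} (hf : P.eval f = 0) {s : ℕ}
    (hs : ∀ i < s, PowerSeries.coeff i (P.derivative.eval f) = 0)
    (hc : ∀ r, PowerSeries.coeff s (P.derivative.eval f) * r ∈ S → r ∈ S)
    (hfs : ∀ i ≤ s, PowerSeries.coeff i f ∈ S) : f ∈ coeffSubring S := by
  intro n
  induction n using Nat.strong_induction_on with
  | _ n ih =>
    rcases le_or_gt n s with hn | hn
    · exact hfs n hn
    apply hc
    set A : R⟦X⟧ := (PowerSeries.trunc n f).toPowerSeries with hA
    have hAmem : A ∈ coeffSubring S := by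
      intro i
      rw [hA, Polynomial.coeff_coe, PowerSeries.coeff_trunc]
      split_ifs with h
      exacts [ih i h, S.zero_mem]
    obtain ⟨h, hh⟩ : PowerSeries.X ^ n ∣ f - A := by
      rw [PowerSeries.X_pow_dvd_iff]
      intro m hm
      rw [map_sub, hA, Polynomial.coeff_coe, PowerSeries.coeff_trunc, if_pos hm, sub_self]
    have hfA : f = A + PowerSeries.X ^ n * h := by rw [← hh]; ring
    have hh0 : PowerSeries.coeff 0 h = PowerSeries.coeff n f := by
      have := congrArg (PowerSeries.coeff n) hh
      rw [PowerSeries.coeff_X_pow_mul', if_pos le_rfl, Nat.sub_self, map_sub, hA,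
        Polynomial.coeff_coe, PowerSeries.coeff_trunc, if_neg (lt_irrefl n), sub_zero] at this
      exact this.symm
    obtain ⟨k, hk⟩ := P.binomExpansion A (PowerSeries.X ^ n * h)
    rw [← hfA, hf] at hk
    obtain ⟨d, hd⟩ : PowerSeries.X ^ n ∣ P.derivative.eval f - P.derivative.eval A :=
      Dvd.dvd.trans ⟨h, hh⟩ (Polynomial.sub_dvd_eval_sub f A P.derivative)
    have hdA : P.derivative.eval A = P.derivative.eval f - PowerSeries.X ^ n * d := by
      rw [← hd]; ring
    have key : -(P.eval A) = PowerSeries.X ^ n * (P.derivative.eval f * h) +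
        PowerSeries.X ^ (n + n) * (k * h ^ 2 - d * h) := by
      rw [hdA] at hk
      rw [← sub_eq_zero]
      rw [← sub_eq_zero] at hk
      rw [pow_add]
      linear_combination hk
    have h1 := congrArg (PowerSeries.coeff (n + s)) key
    rw [map_add, PowerSeries.coeff_X_pow_mul', PowerSeries.coeff_X_pow_mul',
      if_pos (Nat.le_add_right n s), if_neg (by omega), Nat.add_sub_cancel_left, add_zero,
      PowerSeries.coeff_mul, Finset.Nat.sum_antidiagonal_eq_sum_range_succ_mk,
      Finset.sum_range_succ, Nat.sub_self, hh0] at h1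
    rw [Finset.sum_eq_zero, zero_add] at h1
    · rw [← h1]
      exact (coeffSubring S).neg_mem (eval_mem_of_coeff_mem hP hAmem) _
    · intro i hi
      rw [hs i (Finset.mem_range.1 hi), zero_mul]

end CoeffSubring

/-! ### Power series which become polynomials after multiplication by a power of `D` -/

section FieldCoefficients

variable {K : Type*} [Field K]

/-- The subring `K[X][1/D] ∩ K⟦X⟧` of `K⟦X⟧`. -/
def fracSubring (D : K[X]) : Subring K⟦X⟧ where
  carrier := {g | ∃ n, ∃ q : K[X], ((D ^ n : K[X]) : K⟦X⟧) * g = q}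
  mul_mem' := by
    rintro f g ⟨n, q, h⟩ ⟨m, r, h'⟩
    refine ⟨n + m, q * r, ?_⟩
    rw [pow_add, Polynomial.coe_mul, Polynomial.coe_mul, ← h, ← h']
    ring
  one_mem' := ⟨0, 1, by simp⟩
  add_mem' := by
    rintro f g ⟨n, q, h⟩ ⟨m, r, h'⟩
    refine ⟨n + m, D ^ m * q + D ^ n * r, ?_⟩
    rw [pow_add, Polynomial.coe_add, Polynomial.coe_mul, Polynomial.coe_mul, Polynomial.coe_mul,
      ← h, ← h']
    ring
  zero_mem' := ⟨0, 0, by simp⟩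
  neg_mem' := by
    rintro f ⟨n, q, h⟩
    refine ⟨n, -q, ?_⟩
    rw [Polynomial.coe_neg, ← h]
    ring

/-- The subring of rational functions in `K⟦X⟧`. -/
def ratSubring (K : Type*) [Field K] : Subring K⟦X⟧ where
  carrier := {g | ∃ d : K[X], d ≠ 0 ∧ ∃ q : K[X], (d : K⟦X⟧) * g = q}
  mul_mem' := by
    rintro f g ⟨n, hn, q, h⟩ ⟨m, hm, r, h'⟩
    refine ⟨n * m, mul_ne_zero hn hm, q * r, ?_⟩
    rw [Polynomial.coe_mul, Polynomial.coe_mul, ← h, ← h']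
    ring
  one_mem' := ⟨1, one_ne_zero, 1, by simp⟩
  add_mem' := by
    rintro f g ⟨n, hn, q, h⟩ ⟨m, hm, r, h'⟩
    refine ⟨n * m, mul_ne_zero hn hm, m * q + n * r, ?_⟩
    rw [Polynomial.coe_add, Polynomial.coe_mul, Polynomial.coe_mul, Polynomial.coe_mul,
      ← h, ← h']
    ring
  zero_mem' := ⟨1, one_ne_zero, 0, by simp⟩
  neg_mem' := by
    rintro f ⟨n, hn, q, h⟩
    refine ⟨n, hn, -q, ?_⟩
    rw [Polynomial.coe_neg, ← h]
    ring

theorem coe_mem_fracSubring (D q : K[X]) : (q : K⟦X⟧) ∈ fracSubring D := ⟨0, q, by simp⟩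

theorem coe_mem_ratSubring (q : K[X]) : (q : K⟦X⟧) ∈ ratSubring K :=
  ⟨1, one_ne_zero, q, by simp⟩

theorem C_mem_fracSubring (D : K[X]) (a : K) : PowerSeries.C a ∈ fracSubring D := by
  simpa using coe_mem_fracSubring D (C a)

theorem X_mem_fracSubring (D : K[X]) : PowerSeries.X ∈ fracSubring D := by
  simpa using coe_mem_fracSubring D X

theorem mem_fracSubring_of_mul_eq {D d q : K[X]} (hd : d ∣ D) {g : K⟦X⟧}
    (h : (d : K⟦X⟧) * g = q) : g ∈ fracSubring D := by
  obtain ⟨e, rfl⟩ := hd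
  refine ⟨1, e * q, ?_⟩
  rw [pow_one, Polynomial.coe_mul, Polynomial.coe_mul, ← h]
  ring

/-- An element `e = q / d` of `K⟦X⟧` can be cancelled in `fracSubring D` if `q ∣ D`. -/
theorem fracSubring_cancel {D d q : K[X]} (hq : q ∣ D) {e : K⟦X⟧} (h : (d : K⟦X⟧) * e = q)
    {r : K⟦X⟧} (hr : e * r ∈ fracSubring D) : r ∈ fracSubring D := by
  obtain ⟨D', hD'⟩ := hq
  obtain ⟨n, t, ht⟩ := hr
  refine ⟨n + 1, D' * d * t, ?_⟩
  have : ((D ^ (n + 1) : K[X]) : K⟦X⟧) = (D ^ n : K[X]) * (q * D') := by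
    rw [pow_succ, Polynomial.coe_mul, ← Polynomial.coe_mul q, ← hD']
  rw [this, Polynomial.coe_mul, Polynomial.coe_mul, ← ht, ← h]
  ring

theorem ratSubring_cancel {e : K⟦X⟧} (he : e ∈ ratSubring K) (he0 : e ≠ 0) {r : K⟦X⟧}
    (hr : e * r ∈ ratSubring K) : r ∈ ratSubring K := by
  obtain ⟨d, hd, q, h⟩ := he
  obtain ⟨d', hd', q', h'⟩ := hr
  have hd0 : (d : K⟦X⟧) ≠ 0 := by simpa using hd
  have hq0 : q ≠ 0 := by
    rintro rfl
    rw [Polynomial.coe_zero] at h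
    exact (mul_ne_zero hd0 he0) h
  refine ⟨d' * q, mul_ne_zero hd' hq0, d * q', ?_⟩
  rw [Polynomial.coe_mul, Polynomial.coe_mul, ← h, ← h']
  ring

/-! ### The functional equation and transcendence of its solution -/

/-- The endomorphism `X ↦ X ^ 9` of `R⟦X⟧`. -/
noncomputable def expandHom (R : Type*) [CommRing R] : R⟦X⟧ →+* R⟦X⟧ where
  toFun f := PowerSeries.expand 9 (by norm_num) f
  map_one' := map_one _
  map_mul' f g := map_mul _ f g
  map_zero' := map_zero _
  map_add' f g := map_add _ f g

theorem expandHom_apply {R : Type*} [CommRing R] (f : R⟦X⟧) :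
    expandHom R f = PowerSeries.expand 9 (by norm_num) f := rfl

theorem expandHom_C {R : Type*} [CommRing R] (r : R) :
    expandHom R (PowerSeries.C r) = PowerSeries.C r :=
  PowerSeries.expand_C 9 (by norm_num) r

/-- The endomorphism `x ↦ x ^ 9` of `K⟦X⟧`. -/
noncomputable def innerShift (K : Type*) [Field K] : K⟦X⟧ →+* K⟦X⟧ := expandHom K

/-- The endomorphism `x ↦ x ^ 9`, `y ↦ y ^ 9` of `K⟦x⟧⟦y⟧`. -/
noncomputable def shift (K : Type*) [Field K] : K⟦X⟧⟦X⟧ →+* K⟦X⟧⟦X⟧ :=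
  (expandHom K⟦X⟧).comp (PowerSeries.map (innerShift K))

/-- A constant of `K`, as a series in `K⟦x⟧⟦y⟧`. -/
noncomputable def cst : K →+* K⟦X⟧⟦X⟧ := PowerSeries.C.comp PowerSeries.C

/-- The inner variable `x` of `K⟦x⟧⟦y⟧`. -/
noncomputable def varX : K⟦X⟧⟦X⟧ := PowerSeries.C PowerSeries.X

/-- The outer variable `y` of `K⟦x⟧⟦y⟧`. -/
noncomputable def varY : K⟦X⟧⟦X⟧ := PowerSeries.X

/-- The inclusion `K[x][y] → K⟦x⟧⟦y⟧`. -/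
noncomputable def polyToSeries (K : Type*) [Field K] : K[X][X] →+* K⟦X⟧⟦X⟧ :=
  Polynomial.coeToPowerSeries.ringHom.comp (mapRingHom Polynomial.coeToPowerSeries.ringHom)

theorem coeff_polyToSeries (q : K[X][X]) (n : ℕ) :
    PowerSeries.coeff n (polyToSeries K q) = (q.coeff n : K[X]).toPowerSeries := by
  simp [polyToSeries]

theorem polyToSeries_injective : Function.Injective (polyToSeries K) := by
  intro q r h
  ext1 n
  have := congrArg (PowerSeries.coeff n) h
  rw [coeff_polyToSeries, coeff_polyToSeries] at this
  exact_mod_cast this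

theorem coeff_shift (f : K⟦X⟧⟦X⟧) (n : ℕ) : PowerSeries.coeff n (shift K f) =
    if 9 ∣ n then innerShift K (PowerSeries.coeff (n / 9) f) else 0 := by
  simp [shift, PowerSeries.coeff_expand, expandHom_apply]

theorem innerShift_X : innerShift K PowerSeries.X = PowerSeries.X ^ 9 := by
  simp [innerShift, expandHom_apply]

theorem innerShift_C (a : K) : innerShift K (PowerSeries.C a) = PowerSeries.C a := by
  exact expandHom_C a

theorem shift_varY : shift K varY = varY ^ 9 := by
  simp [shift, varY, expandHom_apply]

theorem shift_C (g : K⟦X⟧) :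
    shift K (PowerSeries.C g) = PowerSeries.C (innerShift K g) := by
  simp only [shift, RingHom.comp_apply, PowerSeries.map_C]
  exact expandHom_C _

theorem shift_varX : shift K varX = varX ^ 9 := by
  rw [varX, shift_C, innerShift_X, map_pow]

theorem shift_cst (a : K) : shift K (cst a) = cst a := by
  rw [cst, RingHom.comp_apply, shift_C, innerShift_C]

theorem innerShift_coe (q : K[X]) :
    innerShift K (q : K⟦X⟧) = (Polynomial.expand K 9 q : K[X]).toPowerSeries := by
  ext n
  simp only [innerShift, expandHom_apply, PowerSeries.coeff_expand, Polynomial.coeff_coe]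
  rw [Polynomial.coeff_expand (by norm_num)]

theorem innerShift_mem_ratSubring {g : K⟦X⟧} (hg : g ∈ ratSubring K) :
    innerShift K g ∈ ratSubring K := by
  obtain ⟨d, hd, q, h⟩ := hg
  refine ⟨Polynomial.expand K 9 d, (Polynomial.expand_ne_zero (by norm_num)).2 hd,
    Polynomial.expand K 9 q, ?_⟩
  rw [← innerShift_coe, ← innerShift_coe, ← h, map_mul]

/-- `f(x, y)` is related to `f(x ^ 9, y ^ 9)` by a fractional linear transformation, and
`f(0, 0) = 0`. -/
structure IsMahlerSolution (c s : K) (f : K⟦X⟧⟦X⟧) : Prop where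
  coeff_zero : PowerSeries.coeff 0 (PowerSeries.coeff 0 f) = 0
  eq : (f - cst c * varX) * (shift K f - cst s) =
    varY * (f - cst s * varX) * (shift K f - cst c)

section Mahler

variable {c s : K} {f : K⟦X⟧⟦X⟧}

theorem IsMahlerSolution.constCoeff (hs : s ≠ 0) (hf : IsMahlerSolution c s f) :
    PowerSeries.constantCoeff f = PowerSeries.C c * PowerSeries.X := by
  have h := congrArg PowerSeries.constantCoeff hf.eq
  simp only [map_mul, map_sub, varY, PowerSeries.constantCoeff_X, zero_mul, mul_eq_zero, cst,
    varX, RingHom.comp_apply, PowerSeries.constantCoeff_C] at h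
  rcases h with h | h
  · exact sub_eq_zero.1 h
  · exfalso
    rw [← PowerSeries.coeff_zero_eq_constantCoeff_apply, coeff_shift] at h
    have h2 := congrArg PowerSeries.constantCoeff h
    have h3 := hf.coeff_zero
    simp only [innerShift, expandHom_apply] at h2
    simp_all

theorem IsMahlerSolution.mem_ratSubring (hs : s ≠ 0)
    (hf : IsMahlerSolution c s f) : f ∈ coeffSubring (ratSubring K) := by
  have hC (a : K) : PowerSeries.C a ∈ ratSubring K := by
    simpa using coe_mem_ratSubring (C a)
  have hX : (PowerSeries.X : K⟦X⟧) ∈ ratSubring K := by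
    simpa using coe_mem_ratSubring (X : K[X])
  intro n
  induction n using Nat.strong_induction_on with
  | _ n ih =>
    rcases Nat.eq_zero_or_pos n with rfl | hn
    · rw [PowerSeries.coeff_zero_eq_constantCoeff_apply, hf.constCoeff hs]
      exact Subring.mul_mem _ (hC c) hX
    have hw : ∀ i ≤ n, PowerSeries.coeff i (shift K f) ∈ ratSubring K := by
      intro i hi
      rw [coeff_shift]
      split_ifs with h
      · exact innerShift_mem_ratSubring (ih _ (by omega))
      · exact Subring.zero_mem _
    set w := shift K f with hwdef
    set W : K⟦X⟧⟦X⟧ := (PowerSeries.trunc (n + 1) w).toPowerSeries with hW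
    have hWmem : W ∈ coeffSubring (ratSubring K) := by
      intro i
      rw [hW, Polynomial.coeff_coe, PowerSeries.coeff_trunc]
      split_ifs with h
      exacts [hw i (by omega), Subring.zero_mem _]
    obtain ⟨V, hV⟩ : PowerSeries.X ^ (n + 1) ∣ w - W := by
      rw [PowerSeries.X_pow_dvd_iff]
      intro m hm
      rw [map_sub, hW, Polynomial.coeff_coe, PowerSeries.coeff_trunc, if_pos hm, sub_self]
    set F : K⟦X⟧⟦X⟧ := (PowerSeries.trunc n f).toPowerSeries with hF
    have hFmem : F ∈ coeffSubring (ratSubring K) := by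
      intro i
      rw [hF, Polynomial.coeff_coe, PowerSeries.coeff_trunc]
      split_ifs with h
      exacts [ih i h, Subring.zero_mem _]
    obtain ⟨G, hG⟩ : PowerSeries.X ^ n ∣ f - F := by
      rw [PowerSeries.X_pow_dvd_iff]
      intro m hm
      rw [map_sub, hF, Polynomial.coeff_coe, PowerSeries.coeff_trunc, if_pos hm, sub_self]
    have hG0 : PowerSeries.coeff 0 G = PowerSeries.coeff n f := by
      have := congrArg (PowerSeries.coeff n) hG
      rw [PowerSeries.coeff_X_pow_mul', if_pos le_rfl, Nat.sub_self, map_sub, hF,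
        Polynomial.coeff_coe, PowerSeries.coeff_trunc, if_neg (lt_irrefl n), sub_zero] at this
      exact this.symm
    have hcst (a : K) : cst a ∈ coeffSubring (ratSubring K) := C_mem_coeffSubring (hC a)
    have hvX : varX ∈ coeffSubring (ratSubring K) := C_mem_coeffSubring hX
    have hvY : varY ∈ coeffSubring (ratSubring K) := X_mem_coeffSubring
    set D := (W - cst s) - varY * (W - cst c) with hD
    have hDmem : D ∈ coeffSubring (ratSubring K) :=
      Subring.sub_mem _ (Subring.sub_mem _ hWmem (hcst s))
        (Subring.mul_mem _ hvY (Subring.sub_mem _ hWmem (hcst c)))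
    set N := varX * (cst c * (W - cst s) - cst s * varY * (W - cst c)) with hN
    have hNmem : N ∈ coeffSubring (ratSubring K) :=
      Subring.mul_mem _ hvX (Subring.sub_mem _
        (Subring.mul_mem _ (hcst c) (Subring.sub_mem _ hWmem (hcst s)))
        (Subring.mul_mem _ (Subring.mul_mem _ (hcst s) hvY)
          (Subring.sub_mem _ hWmem (hcst c))))
    have key : N - F * D = PowerSeries.X ^ n * (D * G) +
        PowerSeries.X ^ (n + 1) * (f * V * (1 - varY) -
          varX * (cst c * V - cst s * varY * V)) := by
      have h1 := hf.eq
      have hw' : w = W + PowerSeries.X ^ (n + 1) * V := by rw [← hV]; ring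
      have hf' : PowerSeries.X ^ n * G = f - F := hG.symm
      have e : PowerSeries.X ^ n * (D * G) = (f - F) * D := by rw [← hf']; ring
      rw [e, hD, hN]
      rw [← hwdef, hw'] at h1
      linear_combination (-1 : K⟦X⟧⟦X⟧) * h1
    have h1 := congrArg (PowerSeries.coeff n) key
    rw [map_add, PowerSeries.coeff_X_pow_mul', PowerSeries.coeff_X_pow_mul', if_pos le_rfl,
      if_neg (by omega), Nat.sub_self, add_zero, PowerSeries.coeff_zero_eq_constantCoeff_apply,
      map_mul, ← PowerSeries.coeff_zero_eq_constantCoeff_apply D,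
      ← PowerSeries.coeff_zero_eq_constantCoeff_apply G, hG0] at h1
    have h2 : PowerSeries.coeff 0 D * PowerSeries.coeff n f ∈ ratSubring K := by
      rw [← h1]
      exact Subring.sub_mem _ hNmem (Subring.mul_mem _ hFmem hDmem) n
    refine ratSubring_cancel (hDmem 0) ?_ h2
    have hW0 : PowerSeries.coeff 0 W = PowerSeries.C c * PowerSeries.X ^ 9 := by
      rw [hW, Polynomial.coeff_coe, PowerSeries.coeff_trunc, if_pos (by omega), coeff_shift,
        if_pos (dvd_zero 9), Nat.zero_div, PowerSeries.coeff_zero_eq_constantCoeff_apply,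
        hf.constCoeff hs, map_mul, innerShift_C, innerShift_X]
    rw [PowerSeries.coeff_zero_eq_constantCoeff_apply] at hW0 ⊢
    simp only [hD, map_sub, map_mul, hW0, varY, PowerSeries.constantCoeff_X, zero_mul, sub_zero,
      cst, RingHom.comp_apply, PowerSeries.constantCoeff_C]
    intro h
    have := congrArg PowerSeries.constantCoeff h
    simp [hs] at this

/-- If one side of the fractional linear relation has coefficients in `K[X][1/D]`, then so has
the other side, and `D` has a factor in common with the resulting pole. -/
theorem mem_fracSubring_step {D : K[X]} (hXD : X ∣ D) (hcs : c ≠ s) (hs : s ≠ 0) {m : ℕ}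
    (hm : m ≠ 0) {w v : K⟦X⟧⟦X⟧} (hw : w ∈ coeffSubring (fracSubring D))
    (hw0 : PowerSeries.constantCoeff w = PowerSeries.C c * PowerSeries.X ^ m)
    (hv0 : PowerSeries.constantCoeff v = PowerSeries.C c * PowerSeries.X ^ (9 * m))
    (h : (w - cst c * varX ^ m) * (v - cst s) = varY ^ m * (w - cst s * varX ^ m) * (v - cst c)) :
    v ∈ coeffSubring (fracSubring D) ∧ ∃ n, (C c * X ^ (9 * m) - C s) ∣ D ^ n := by
  have hcst (a : K) : cst a ∈ coeffSubring (fracSubring D) :=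
    C_mem_coeffSubring (C_mem_fracSubring D a)
  have hvX : varX ∈ coeffSubring (fracSubring D) :=
    C_mem_coeffSubring (X_mem_fracSubring D)
  have hcs' : c - s ≠ 0 := sub_ne_zero.2 hcs
  have hunit : IsUnit (v - cst s) := by
    rw [PowerSeries.isUnit_iff_constantCoeff, PowerSeries.isUnit_iff_constantCoeff]
    simp [hv0, cst, hs, hm]
  obtain ⟨u, hu⟩ := hunit
  set τ := (v - cst c) * (↑u⁻¹ : K⟦X⟧⟦X⟧) with hτ
  have hτu : τ * (v - cst s) = v - cst c := by
    rw [hτ, ← hu, mul_assoc, Units.inv_mul, mul_one]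
  have h1 : varY ^ m * ((w - cst s * varX ^ m) * τ) = w - cst c * varX ^ m := by
    apply u.isUnit.mul_right_cancel
    rw [hu, h]
    linear_combination varY ^ m * (w - cst s * varX ^ m) * hτu
  have hτmem : τ ∈ coeffSubring (fracSubring D) := by
    have h2 : (w - cst s * varX ^ m) * τ ∈ coeffSubring (fracSubring D) := by
      refine mem_coeffSubring_of_X_pow_mul (m := m) ?_
      change varY ^ m * ((w - cst s * varX ^ m) * τ) ∈ _
      rw [h1]
      exact Subring.sub_mem _ hw (Subring.mul_mem _ (hcst c) (Subring.pow_mem _ hvX m))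
    refine mem_coeffSubring_of_mul_mem
      (Subring.sub_mem _ hw (Subring.mul_mem _ (hcst s) (Subring.pow_mem _ hvX m))) h2 ?_
    intro r hr
    rw [PowerSeries.coeff_zero_eq_constantCoeff_apply] at hr
    have e : PowerSeries.constantCoeff (w - cst s * varX ^ m) =
        PowerSeries.C (c - s) * PowerSeries.X ^ m := by
      simp only [map_sub, map_mul, map_pow, hw0, cst, varX, RingHom.comp_apply,
        PowerSeries.constantCoeff_C]
      ring
    rw [e] at hr
    have hr' : PowerSeries.X ^ m * r ∈ fracSubring D := by
      have := Subring.mul_mem _ (C_mem_fracSubring D (c - s)⁻¹) hr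
      rwa [← mul_assoc, ← mul_assoc, ← map_mul, inv_mul_cancel₀ hcs', map_one, one_mul] at this
    clear hr h2 h1 hτ hτu e h hv0 hw0 hm
    induction m with
    | zero => simpa using hr'
    | succ m ih =>
      apply ih
      refine fracSubring_cancel hXD (d := 1) (e := PowerSeries.X) (by simp) ?_
      rwa [pow_succ', mul_assoc] at hr'
  have h3 : (1 - τ) * (v - cst s) = cst (c - s) := by
    rw [sub_mul, hτu, map_sub]
    ring
  have hG : ((C c * X ^ (9 * m) - C s : K[X]) : K⟦X⟧) =
      PowerSeries.constantCoeff (v - cst s) := by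
    simp [hv0, cst, Polynomial.coe_sub]
  set τ0 := PowerSeries.constantCoeff τ with hτ0
  have h4 : (1 - τ0) * ((C c * X ^ (9 * m) - C s : K[X]) : K⟦X⟧) = PowerSeries.C (c - s) := by
    rw [hG, hτ0, ← map_one PowerSeries.constantCoeff, ← map_sub, ← map_mul, h3, cst,
      RingHom.comp_apply, PowerSeries.constantCoeff_C]
  have h1τ : 1 - τ ∈ coeffSubring (fracSubring D) := Subring.sub_mem _ (Subring.one_mem _) hτmem
  constructor
  · have : v - cst s ∈ coeffSubring (fracSubring D) := by
      refine mem_coeffSubring_of_mul_mem h1τ (by rw [h3]; exact hcst _) ?_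
      intro r hr
      rw [PowerSeries.coeff_zero_eq_constantCoeff_apply, map_sub, map_one, ← hτ0] at hr
      have := Subring.mul_mem _ (C_mem_fracSubring D (c - s)⁻¹) (Subring.mul_mem _
        (coe_mem_fracSubring D (C c * X ^ (9 * m) - C s)) hr)
      have e : PowerSeries.C (c - s)⁻¹ * (((C c * X ^ (9 * m) - C s : K[X]) : K⟦X⟧) *
          ((1 - τ0) * r)) = PowerSeries.C (c - s)⁻¹ * PowerSeries.C (c - s) * r := by
        rw [← h4]; ring
      rwa [e, ← map_mul, inv_mul_cancel₀ hcs', map_one, one_mul] at this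
    have := Subring.add_mem _ this (hcst s)
    rwa [sub_add_cancel] at this
  · have h5 : 1 - τ0 ∈ fracSubring D := by
      have := h1τ 0
      rwa [PowerSeries.coeff_zero_eq_constantCoeff_apply, map_sub, map_one] at this
    obtain ⟨n, q, hq⟩ := h5
    refine ⟨n, C (c - s)⁻¹ * q, ?_⟩
    have h6 : ((D ^ n * C (c - s) : K[X]) : K⟦X⟧) =
        ((q * (C c * X ^ (9 * m) - C s) : K[X]) : K⟦X⟧) := by
      rw [Polynomial.coe_mul, Polynomial.coe_mul, ← hq, Polynomial.coe_C, ← h4]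
      ring
    have h7 : D ^ n * C (c - s) = q * (C c * X ^ (9 * m) - C s) := by exact_mod_cast h6
    have h8 : D ^ n = D ^ n * C (c - s) * C (c - s)⁻¹ := by
      rw [mul_assoc, ← C_mul, mul_inv_cancel₀ hcs', C_1, mul_one]
    rw [h8, h7]
    ring

theorem IsMahlerSolution.iterate_constCoeff (hs : s ≠ 0) (hf : IsMahlerSolution c s f) (j : ℕ) :
    PowerSeries.constantCoeff ((shift K)^[j] f) = PowerSeries.C c * PowerSeries.X ^ 9 ^ j := by
  induction j with
  | zero => simpa using hf.constCoeff hs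
  | succ j ih =>
    rw [Function.iterate_succ_apply', ← PowerSeries.coeff_zero_eq_constantCoeff_apply,
      coeff_shift, if_pos (dvd_zero 9), Nat.zero_div,
      PowerSeries.coeff_zero_eq_constantCoeff_apply, ih, map_mul, map_pow, innerShift_C,
      innerShift_X, ← pow_mul, pow_succ']

theorem IsMahlerSolution.iterate_eq (hf : IsMahlerSolution c s f) (j : ℕ) :
    ((shift K)^[j] f - cst c * varX ^ 9 ^ j) * ((shift K)^[j + 1] f - cst s) =
      varY ^ 9 ^ j * ((shift K)^[j] f - cst s * varX ^ 9 ^ j) *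
        ((shift K)^[j + 1] f - cst c) := by
  induction j with
  | zero => simpa using hf.eq
  | succ j ih =>
    have := congrArg (shift K) ih
    simpa only [map_mul, map_sub, map_pow, shift_cst, shift_varX, shift_varY,
      ← Function.iterate_succ_apply', ← pow_mul, ← pow_succ'] using this

theorem not_forall_dvd_pow {c s : K} (hc : c ≠ 0) (hs : s ≠ 0)
    (hcs : ∀ n, n ≠ 0 → (s / c) ^ n ≠ 1) {D : K[X]} (hD : D ≠ 0) :
    ¬ ∀ j : ℕ, ∃ n, (C c * X ^ 9 ^ (j + 1) - C s) ∣ D ^ n := by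
  intro h
  have hdeg (j : ℕ) : (C c * X ^ 9 ^ (j + 1) - C s : K[X]).natDegree = 9 ^ (j + 1) := by
    rw [natDegree_sub_C, natDegree_C_mul_X_pow _ _ hc]
  have hirr (j : ℕ) : ∃ q : K[X], Irreducible q ∧ q ∣ C c * X ^ 9 ^ (j + 1) - C s := by
    apply Polynomial.exists_irreducible_of_natDegree_pos
    rw [hdeg]
    positivity
  choose q hq hqd using hirr
  have hcop : ∀ i j, i < j → IsCoprime (q i) (q j) := by
    intro i j hij
    rw [(hq i).coprime_iff_not_dvd]
    intro hdvd
    have h1 : q i ∣ C c * X ^ 9 ^ (j + 1) - C s := hdvd.trans (hqd j)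
    obtain ⟨k, rfl⟩ := Nat.exists_eq_add_of_lt hij
    have hX : q i ∣ X ^ 9 ^ (i + 1) - C (s / c) := by
      have := (hqd i).mul_left (C c⁻¹)
      rwa [mul_sub, ← mul_assoc, ← C_mul, ← C_mul, inv_mul_cancel₀ hc, C_1, one_mul,
        inv_mul_eq_div] at this
    have hX' : q i ∣ X ^ 9 ^ (i + k + 1 + 1) - C (s / c) := by
      have := h1.mul_left (C c⁻¹)
      rwa [mul_sub, ← mul_assoc, ← C_mul, ← C_mul, inv_mul_cancel₀ hc, C_1, one_mul,
        inv_mul_eq_div] at this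
    have h2 : q i ∣ (X ^ 9 ^ (i + 1)) ^ 9 ^ (k + 1) - C (s / c) ^ 9 ^ (k + 1) :=
      hX.trans (sub_dvd_pow_sub_pow _ _ _)
    rw [← pow_mul, ← pow_add, show i + 1 + (k + 1) = i + k + 1 + 1 by ring] at h2
    have h3 := dvd_sub hX' h2
    rw [sub_sub_sub_cancel_left, ← C_pow, ← C_sub] at h3
    have hne : (s / c) ^ 9 ^ (k + 1) - s / c ≠ 0 := by
      obtain ⟨e, he⟩ : ∃ e, 9 ^ (k + 1) = e + 1 :=
        ⟨9 ^ (k + 1) - 1, (Nat.sub_add_cancel (Nat.one_le_pow _ _ (by norm_num))).symm⟩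
      have he0 : e ≠ 0 := by
        rintro rfl
        have : 9 ≤ 9 ^ (k + 1) := Nat.le_self_pow (by omega) 9
        omega
      rw [he, pow_succ, ← sub_one_mul]
      exact mul_ne_zero (sub_ne_zero.2 (hcs e he0)) (div_ne_zero hs hc)
    exact (hq i).not_isUnit (isUnit_of_dvd_unit h3 (isUnit_C.2 hne.isUnit))
  have hqD (j : ℕ) : q j ∣ D := by
    obtain ⟨n, hn⟩ := h j
    exact (hq j).prime.dvd_of_dvd_pow ((hqd j).trans hn)
  have hprod : ∏ i ∈ Finset.range (D.natDegree + 1), q i ∣ D := by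
    apply Finset.prod_dvd_of_coprime
    · intro i _ j _ hij
      rcases lt_or_gt_of_ne hij with h | h
      exacts [hcop i j h, (hcop j i h).symm]
    · exact fun i _ => hqD i
  have h1 := natDegree_le_of_dvd hprod hD
  rw [natDegree_prod _ _ fun i _ => (hq i).ne_zero] at h1
  have h2 : ∑ i ∈ Finset.range (D.natDegree + 1), 1 ≤
      ∑ i ∈ Finset.range (D.natDegree + 1), (q i).natDegree :=
    Finset.sum_le_sum fun i _ => (hq i).natDegree_pos
  simp at h2
  omega

/-- A solution of the functional equation is transcendental over `K(x, y)`. -/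
theorem IsMahlerSolution.eval₂_ne_zero [CharZero K] (hc : c ≠ 0) (hs : s ≠ 0)
    (hcs : ∀ n, n ≠ 0 → (s / c) ^ n ≠ 1) (hf : IsMahlerSolution c s f)
    {P : K[X][X][X]} (hP : P ≠ 0) : P.eval₂ (polyToSeries K) f ≠ 0 := by
  intro hPf
  induction hn : P.natDegree using Nat.strong_induction_on generalizing P with
  | _ d ih =>
  by_cases hPd : P.derivative.eval₂ (polyToSeries K) f = 0
  · by_cases hP' : derivative P = 0
    · have h0 := derivative_eq_zero.1 hP'
      rw [eq_C_of_natDegree_eq_zero h0, eval₂_C] at hPf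
      rw [eq_C_of_natDegree_eq_zero h0] at hP
      have := polyToSeries_injective (hPf.trans (map_zero _).symm)
      rw [this, C_0] at hP
      exact hP rfl
    · refine ih _ ?_ hP' hPd rfl
      rw [← hn]
      apply natDegree_derivative_lt
      intro h0
      exact hP' (derivative_eq_zero.2 h0)
  set Q := P.map (polyToSeries K) with hQ
  have hQf : Q.eval f = 0 := by rw [hQ, eval_map, hPf]
  have hQd : Q.derivative.eval f ≠ 0 := by rwa [hQ, derivative_map, eval_map]
  have hrat := hf.mem_ratSubring hs
  have hpoly (S : Subring K⟦X⟧) (hS : ∀ q : K[X], (q : K⟦X⟧) ∈ S) (i : ℕ) :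
      Q.coeff i ∈ coeffSubring S := by
    intro n
    rw [hQ, coeff_map, coeff_polyToSeries]
    exact hS _
  have hQdrat : Q.derivative.eval f ∈ coeffSubring (ratSubring K) := by
    refine eval_mem_of_coeff_mem (fun i => ?_) hrat
    rw [coeff_derivative]
    exact Subring.mul_mem _ (hpoly _ coe_mem_ratSubring _)
      (Subring.add_mem _ (natCast_mem _ _) (Subring.one_mem _))
  classical
  have hex : ∃ n, PowerSeries.coeff n (Q.derivative.eval f) ≠ 0 := by
    by_contra! hcon
    exact hQd (PowerSeries.ext fun n => by simpa using hcon n)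
  set t := Nat.find hex
  have ht : PowerSeries.coeff t (Q.derivative.eval f) ≠ 0 := Nat.find_spec hex
  have ht' : ∀ i < t, PowerSeries.coeff i (Q.derivative.eval f) = 0 := fun i hi =>
    not_not.1 (Nat.find_min hex hi)
  obtain ⟨d₀, hd₀, q₀, hq₀⟩ := hQdrat t
  have hq₀0 : q₀ ≠ 0 := by
    rintro rfl
    rw [Polynomial.coe_zero] at hq₀
    exact mul_ne_zero (by simpa using hd₀) ht hq₀
  choose e he0 r hr using hrat
  set D : K[X] := X * q₀ * ∏ i ∈ Finset.range (t + 1), e i with hD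
  have hD0 : D ≠ 0 := mul_ne_zero (mul_ne_zero X_ne_zero hq₀0)
    (Finset.prod_ne_zero_iff.2 fun i _ => he0 i)
  have hXD : X ∣ D := ⟨q₀ * ∏ i ∈ Finset.range (t + 1), e i, by rw [hD, mul_assoc]⟩
  have hqD : q₀ ∣ D := ⟨X * ∏ i ∈ Finset.range (t + 1), e i, by rw [hD]; ring⟩
  have hfD : f ∈ coeffSubring (fracSubring D) := by
    refine mem_coeffSubring_of_root (hpoly _ (coe_mem_fracSubring D)) hQf ht'
      (fun r hr => fracSubring_cancel hqD hq₀ hr) ?_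
    intro i hi
    exact mem_fracSubring_of_mul_eq ((Finset.dvd_prod_of_mem e
      (Finset.mem_range.2 (Nat.lt_succ_of_le hi))).mul_left _) (hr i)
  have hcs1 : c ≠ s := by
    rintro rfl
    exact hcs 1 one_ne_zero (by rw [div_self hs, one_pow])
  have hstep (j : ℕ) (hj : (shift K)^[j] f ∈ coeffSubring (fracSubring D)) :=
    mem_fracSubring_step (v := (shift K)^[j + 1] f) hXD hcs1 hs (m := 9 ^ j) (by positivity) hj
      (hf.iterate_constCoeff hs j)
      (by rw [← pow_succ']; exact hf.iterate_constCoeff hs (j + 1)) (hf.iterate_eq j)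
  have hall (j : ℕ) : (shift K)^[j] f ∈ coeffSubring (fracSubring D) := by
    induction j with
    | zero => exact hfD
    | succ j ihj => exact (hstep j ihj).1
  refine not_forall_dvd_pow hc hs hcs hD0 fun j => ?_
  rw [pow_succ']
  exact (hstep j (hall j)).2

end Mahler

/-! ### Truncation and existence of a solution -/

/-- The series in `K⟦x⟧⟦y⟧` without monomials `x ^ i y ^ j` with `i, j < n`, that is, the
ideal generated by `x ^ n` and `y ^ n`. -/
def boxIdeal (K : Type*) [Field K] (n : ℕ) : Ideal K⟦X⟧⟦X⟧ where
  carrier := {F | ∀ i < n, ∀ j < n, PowerSeries.coeff i (PowerSeries.coeff j F) = 0}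
  add_mem' {F G} hF hG i hi j hj := by rw [map_add, map_add, hF i hi j hj, hG i hi j hj, add_zero]
  zero_mem' i _ j _ := by simp
  smul_mem' F G hG i hi j hj := by
    rw [smul_eq_mul, PowerSeries.coeff_mul, map_sum]
    refine Finset.sum_eq_zero fun a ha => ?_
    rw [PowerSeries.coeff_mul]
    refine Finset.sum_eq_zero fun b hb => ?_
    have ha := Finset.HasAntidiagonal.mem_antidiagonal.1 ha
    have hb := Finset.HasAntidiagonal.mem_antidiagonal.1 hb
    rw [hG _ (by omega) _ (by omega), mul_zero]

theorem mem_boxIdeal {n : ℕ} {F : K⟦X⟧⟦X⟧} : F ∈ boxIdeal K n ↔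
    ∀ i < n, ∀ j < n, PowerSeries.coeff i (PowerSeries.coeff j F) = 0 := Iff.rfl

theorem boxIdeal_anti {m n : ℕ} (h : m ≤ n) : boxIdeal K n ≤ boxIdeal K m :=
  fun _ hF i hi j hj => hF i (hi.trans_le h) j (hj.trans_le h)

theorem eq_zero_of_forall_mem_boxIdeal {F : K⟦X⟧⟦X⟧} (h : ∀ n, F ∈ boxIdeal K n) : F = 0 := by
  ext j i
  simpa using h (max i j + 1) i (by omega) j (by omega)

theorem shift_mem_boxIdeal {n : ℕ} {F : K⟦X⟧⟦X⟧} (h : F ∈ boxIdeal K n) :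
    shift K F ∈ boxIdeal K (9 * n) := by
  intro i hi j hj
  rw [coeff_shift]
  split_ifs with h9
  · rw [innerShift, expandHom_apply, PowerSeries.coeff_expand]
    split_ifs with h9'
    · exact h _ (by omega) _ (by omega)
    · rfl
  · exact map_zero _

theorem mem_boxIdeal_one {F : K⟦X⟧⟦X⟧} :
    F ∈ boxIdeal K 1 ↔ PowerSeries.constantCoeff (PowerSeries.constantCoeff F) = 0 := by
  simp [mem_boxIdeal]

/-- Every series is congruent to a polynomial modulo `boxIdeal K n`. -/
theorem exists_sub_polyToSeries_mem (n : ℕ) (F : K⟦X⟧⟦X⟧) :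
    ∃ P : K[X][X], F - polyToSeries K P ∈ boxIdeal K n := by
  refine ⟨∑ j ∈ Finset.range n, monomial j (PowerSeries.trunc n (PowerSeries.coeff j F)), ?_⟩
  intro i hi j hj
  rw [map_sub, coeff_polyToSeries, finsetSum_coeff]
  simp only [coeff_monomial, Finset.sum_ite_eq', Finset.mem_range, hj, if_true, map_sub,
    Polynomial.coeff_coe, PowerSeries.coeff_trunc, hi, sub_self]

/-- The numerator of the fractional linear transformation in the functional equation. -/
noncomputable def mahlerNum (c s : K) (w : K⟦X⟧⟦X⟧) : K⟦X⟧⟦X⟧ :=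
  varX * (cst c * (w - cst s) - cst s * varY * (w - cst c))

/-- The denominator of the fractional linear transformation in the functional equation. -/
noncomputable def mahlerDen (c s : K) (w : K⟦X⟧⟦X⟧) : K⟦X⟧⟦X⟧ :=
  (w - cst s) - varY * (w - cst c)

theorem isUnit_mahlerDen {c s : K} (hs : s ≠ 0) {w : K⟦X⟧⟦X⟧} (hw : w ∈ boxIdeal K 1) :
    IsUnit (mahlerDen c s w) := by
  rw [PowerSeries.isUnit_iff_constantCoeff, PowerSeries.isUnit_iff_constantCoeff]
  rw [mem_boxIdeal_one] at hw
  simp [mahlerDen, hw, cst, varY, hs]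

theorem mahlerNum_mem (c s : K) (w : K⟦X⟧⟦X⟧) : mahlerNum c s w ∈ boxIdeal K 1 := by
  simp [mem_boxIdeal_one, mahlerNum, varX]

/-- The map whose fixed points are the solutions of the functional equation. -/
noncomputable def mahlerMap (c s : K) (F : K⟦X⟧⟦X⟧) : K⟦X⟧⟦X⟧ :=
  mahlerNum c s (shift K F) * Ring.inverse (mahlerDen c s (shift K F))

theorem mahlerMap_mem (c s : K) (F : K⟦X⟧⟦X⟧) : mahlerMap c s F ∈ boxIdeal K 1 :=
  Ideal.mul_mem_right _ _ (mahlerNum_mem c s _)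

theorem mahlerMap_mul_den {c s : K} (hs : s ≠ 0) {F : K⟦X⟧⟦X⟧} (hF : F ∈ boxIdeal K 1) :
    mahlerMap c s F * mahlerDen c s (shift K F) = mahlerNum c s (shift K F) := by
  rw [mahlerMap, mul_assoc, Ring.inverse_mul_cancel _ (isUnit_mahlerDen hs
    (boxIdeal_anti (by norm_num) (shift_mem_boxIdeal hF))), mul_one]

theorem mahlerMap_sub_mem {c s : K} (hs : s ≠ 0) {F G : K⟦X⟧⟦X⟧} (hF : F ∈ boxIdeal K 1)
    (hG : G ∈ boxIdeal K 1) {n : ℕ} (h : F - G ∈ boxIdeal K n) :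
    mahlerMap c s F - mahlerMap c s G ∈ boxIdeal K (9 * n) := by
  have h1 := shift_mem_boxIdeal h
  rw [map_sub] at h1
  have hu (F : K⟦X⟧⟦X⟧) (hF : F ∈ boxIdeal K 1) : IsUnit (mahlerDen c s (shift K F)) :=
    isUnit_mahlerDen hs (boxIdeal_anti (by norm_num) (shift_mem_boxIdeal hF))
  have h2 := (hu F hF).mul (hu G hG)
  rw [← (boxIdeal K (9 * n)).mul_unit_mem_iff_mem h2]
  have e : (mahlerMap c s F - mahlerMap c s G) *
      (mahlerDen c s (shift K F) * mahlerDen c s (shift K G)) =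
      mahlerNum c s (shift K F) * mahlerDen c s (shift K G) -
      mahlerNum c s (shift K G) * mahlerDen c s (shift K F) := by
    linear_combination mahlerDen c s (shift K G) * mahlerMap_mul_den hs hF -
      mahlerDen c s (shift K F) * mahlerMap_mul_den hs hG
  rw [e]
  set w := shift K F
  set v := shift K G
  have e2 : mahlerNum c s w * mahlerDen c s v - mahlerNum c s v * mahlerDen c s w =
      (w - v) * (varX * varY * (cst c - cst s) ^ 2) := by
    simp only [mahlerNum, mahlerDen]
    ring
  rw [e2]
  exact Ideal.mul_mem_right _ _ h1

theorem exists_isMahlerSolution (c : K) {s : K} (hs : s ≠ 0) :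
    ∃ f : K⟦X⟧⟦X⟧, IsMahlerSolution c s f := by
  obtain ⟨F, hzero, hsucc⟩ : ∃ F : ℕ → K⟦X⟧⟦X⟧, F 0 = 0 ∧ ∀ m, F (m + 1) = mahlerMap c s (F m) :=
    ⟨fun m => (mahlerMap c s)^[m] 0, rfl, fun m => Function.iterate_succ_apply' _ _ _⟩
  have hF1 (m : ℕ) : F m ∈ boxIdeal K 1 := by
    cases m with
    | zero => rw [hzero]; exact Ideal.zero_mem _
    | succ m => rw [hsucc]; exact mahlerMap_mem c s _
  have hstep (m : ℕ) : F (m + 1) - F m ∈ boxIdeal K (m + 1) := by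
    induction m with
    | zero => exact Ideal.sub_mem _ (hF1 1) (hF1 0)
    | succ m ih =>
      have h := mahlerMap_sub_mem (c := c) hs (hF1 (m + 1)) (hF1 m) ih
      rw [← hsucc (m + 1), ← hsucc m] at h
      exact boxIdeal_anti (show m + 1 + 1 ≤ 9 * (m + 1) by omega) h
  have hcauchy (m k : ℕ) : F (m + k) - F m ∈ boxIdeal K (m + 1) := by
    induction k with
    | zero => simp
    | succ k ih =>
      have h := boxIdeal_anti (show m + 1 ≤ m + k + 1 by omega) (hstep (m + k))
      rw [← add_assoc, ← sub_add_sub_cancel _ (F (m + k))]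
      exact Ideal.add_mem _ h ih
  set f : K⟦X⟧⟦X⟧ := PowerSeries.mk fun j => PowerSeries.mk fun i =>
    PowerSeries.coeff i (PowerSeries.coeff j (F (max i j))) with hf
  have hfF (m : ℕ) : f - F m ∈ boxIdeal K m := by
    intro i hi j hj
    obtain ⟨k, hk⟩ := Nat.exists_eq_add_of_le (show max i j ≤ m by omega)
    have := hcauchy (max i j) k i (by omega) j (by omega)
    rw [← hk, map_sub, map_sub, sub_eq_zero] at this
    simp [hf, PowerSeries.coeff_mk, this]
  have hf1 : f ∈ boxIdeal K 1 := by
    have := Ideal.add_mem _ (hfF 1) (hF1 1)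
    rwa [sub_add_cancel] at this
  have hfix : f = mahlerMap c s f := by
    rw [← sub_eq_zero]
    apply eq_zero_of_forall_mem_boxIdeal
    intro n
    have h1 := boxIdeal_anti (show n ≤ n + 1 by omega) (hfF (n + 1))
    have h2 := boxIdeal_anti (show n ≤ 9 * n by omega)
      (mahlerMap_sub_mem (c := c) hs (hF1 n) hf1 (n := n)
        (by rw [← neg_sub]; exact Submodule.neg_mem _ (hfF n)))
    rw [hsucc] at h1
    have := Ideal.add_mem _ h1 h2
    rwa [sub_add_sub_cancel] at this
  refine ⟨f, ⟨by simpa [mem_boxIdeal] using hf1, ?_⟩⟩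
  have h := mahlerMap_mul_den (c := c) hs hf1
  rw [← hfix, mahlerDen, mahlerNum] at h
  linear_combination h

/-! ### Comparison of sequences with series -/

/-- The endomorphism `x ↦ x ^ 9`, `y ↦ y ^ 9` of `K[x][y]`. -/
noncomputable def polyShift (K : Type*) [Field K] : K[X][X] →+* K[X][X] :=
  (expand K[X] 9 : K[X][X] →+* K[X][X]).comp (mapRingHom (expand K 9 : K[X] →+* K[X]))

theorem coeff_polyShift (P : K[X][X]) (j : ℕ) :
    (polyShift K P).coeff j = if 9 ∣ j then expand K 9 (P.coeff (j / 9)) else 0 := by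
  simp [polyShift, coeff_expand]

theorem polyToSeries_polyShift (P : K[X][X]) :
    polyToSeries K (polyShift K P) = shift K (polyToSeries K P) := by
  ext1 j
  rw [coeff_polyToSeries, coeff_shift, coeff_polyToSeries, coeff_polyShift]
  split_ifs
  · rw [innerShift_coe]
  · exact Polynomial.coe_zero

theorem polyToSeries_C_C (a : K) : polyToSeries K (C (C a)) = cst a := by
  simp [polyToSeries, cst]

theorem polyToSeries_C_X : polyToSeries K (C X) = varX := by
  simp [polyToSeries, varX]

theorem polyToSeries_X : polyToSeries K X = varY := by
  simp [polyToSeries, varY]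

section Approx

variable {L : Type*} [NormedField L] (ι : K →+* L) (ξ υ : L)

/-- Evaluation of polynomials in `K[x][y]` at the points `(ξ ^ 9 ^ k, υ ^ 9 ^ k)`. -/
noncomputable def evalSeq : K[X][X] →+* (ℕ → L) :=
  RingHom.pi fun k => eval₂RingHom (eval₂RingHom ι (ξ ^ 9 ^ k)) (υ ^ 9 ^ k)

theorem evalSeq_apply (P : K[X][X]) (k : ℕ) :
    evalSeq ι ξ υ P k = eval₂ (eval₂RingHom ι (ξ ^ 9 ^ k)) (υ ^ 9 ^ k) P := rfl

theorem evalSeq_C_C (a : K) (k : ℕ) : evalSeq ι ξ υ (C (C a)) k = ι a := by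
  simp [evalSeq_apply]

theorem evalSeq_C_X (k : ℕ) : evalSeq ι ξ υ (C X) k = ξ ^ 9 ^ k := by
  simp [evalSeq_apply]

theorem evalSeq_X (k : ℕ) : evalSeq ι ξ υ X k = υ ^ 9 ^ k := by
  simp [evalSeq_apply]

theorem evalSeq_polyShift (P : K[X][X]) (k : ℕ) :
    evalSeq ι ξ υ (polyShift K P) k = evalSeq ι ξ υ P (k + 1) := by
  have h : (eval₂RingHom (eval₂RingHom ι (ξ ^ 9 ^ k)) (υ ^ 9 ^ k)).comp (polyShift K) =
      eval₂RingHom (eval₂RingHom ι (ξ ^ 9 ^ (k + 1))) (υ ^ 9 ^ (k + 1)) := by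
    ext <;> simp [polyShift, eval₂_pow, ← pow_mul, ← pow_succ]
  exact RingHom.congr_fun h P

theorem evalSeq_eq_sum (P : K[X][X]) (k : ℕ) :
    evalSeq ι ξ υ P k = ∑ j ∈ P.support, ∑ i ∈ (P.coeff j).support,
      ι ((P.coeff j).coeff i) * (ξ ^ 9 ^ k) ^ i * (υ ^ 9 ^ k) ^ j := by
  rw [evalSeq_apply, eval₂_eq_sum, Polynomial.sum]
  refine Finset.sum_congr rfl fun j _ => ?_
  rw [coe_eval₂RingHom, eval₂_eq_sum, Polynomial.sum, Finset.sum_mul]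

variable {ι ξ υ}

theorem norm_evalSeq_le (hξ : ‖ξ‖ ≤ 1) (hυ : ‖υ‖ ≤ ‖ξ‖) {n : ℕ} {P : K[X][X]}
    (hP : polyToSeries K P ∈ boxIdeal K n) :
    ∃ B, ∀ k, ‖evalSeq ι ξ υ P k‖ ≤ B * (‖ξ‖ ^ 9 ^ k) ^ n := by
  refine ⟨∑ j ∈ P.support, ∑ i ∈ (P.coeff j).support, ‖ι ((P.coeff j).coeff i)‖, fun k => ?_⟩
  rw [evalSeq_eq_sum, Finset.sum_mul]
  refine (norm_sum_le _ _).trans (Finset.sum_le_sum fun j _ => ?_)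
  rw [Finset.sum_mul]
  refine (norm_sum_le _ _).trans (Finset.sum_le_sum fun i hi => ?_)
  rw [norm_mul, norm_mul, mul_assoc]
  refine mul_le_mul_of_nonneg_left ?_ (norm_nonneg _)
  simp only [norm_pow]
  have hx0 : 0 ≤ ‖ξ‖ ^ 9 ^ k := by positivity
  have hx1 : ‖ξ‖ ^ 9 ^ k ≤ 1 := pow_le_one₀ (norm_nonneg _) hξ
  have hy : ‖υ‖ ^ 9 ^ k ≤ ‖ξ‖ ^ 9 ^ k := pow_le_pow_left₀ (norm_nonneg _) hυ _
  have hij : n ≤ i + j := by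
    by_contra! h
    have := hP i (by omega) j (by omega)
    rw [coeff_polyToSeries, Polynomial.coeff_coe] at this
    exact mem_support_iff.1 hi this
  calc (‖ξ‖ ^ 9 ^ k) ^ i * (‖υ‖ ^ 9 ^ k) ^ j
      ≤ (‖ξ‖ ^ 9 ^ k) ^ i * (‖ξ‖ ^ 9 ^ k) ^ j := by gcongr
    _ = (‖ξ‖ ^ 9 ^ k) ^ (i + j) := (pow_add _ _ _).symm
    _ ≤ (‖ξ‖ ^ 9 ^ k) ^ n := pow_le_pow_of_le_one hx0 hx1 hij

theorem exists_norm_evalSeq_le (hξ : ‖ξ‖ ≤ 1) (hυ : ‖υ‖ ≤ ‖ξ‖) (P : K[X][X]) :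
    ∃ B, ∀ k, ‖evalSeq ι ξ υ P k‖ ≤ B := by
  simpa using norm_evalSeq_le (ι := ι) (n := 0) (P := P) hξ hυ (fun i hi => absurd hi (by simp))

variable (ι ξ υ) in
/-- The sequence `w` and the series `F` agree up to order `n`: for a polynomial `P` congruent to
`F` modulo `boxIdeal K n`, the values of `P` at `(ξ ^ 9 ^ k, υ ^ 9 ^ k)` differ from `w k` by
`O(ξ ^ (9 ^ k * n))`. -/
def Approx (n : ℕ) (w : ℕ → L) (F : K⟦X⟧⟦X⟧) : Prop :=
  ∃ P : K[X][X], F - polyToSeries K P ∈ boxIdeal K n ∧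
    ∃ B, ∀ k, ‖w k - evalSeq ι ξ υ P k‖ ≤ B * (‖ξ‖ ^ 9 ^ k) ^ n

theorem approx_poly (n : ℕ) (P : K[X][X]) :
    Approx ι ξ υ n (evalSeq ι ξ υ P) (polyToSeries K P) :=
  ⟨P, by simp, 0, by simp⟩

theorem Approx.anti (hξ : ‖ξ‖ ≤ 1) {m n : ℕ} (h : m ≤ n) {w : ℕ → L} {F : K⟦X⟧⟦X⟧}
    (hw : Approx ι ξ υ n w F) : Approx ι ξ υ m w F := by
  obtain ⟨P, hP, B, hB⟩ := hw
  refine ⟨P, boxIdeal_anti h hP, |B|, fun k => (hB k).trans ?_⟩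
  have hx1 : ‖ξ‖ ^ 9 ^ k ≤ 1 := pow_le_one₀ (norm_nonneg _) hξ
  exact mul_le_mul (le_abs_self B) (pow_le_pow_of_le_one (by positivity) hx1 h) (by positivity)
    (abs_nonneg B)

theorem Approx.add {n : ℕ} {w w' : ℕ → L} {F F' : K⟦X⟧⟦X⟧} (h : Approx ι ξ υ n w F)
    (h' : Approx ι ξ υ n w' F') : Approx ι ξ υ n (w + w') (F + F') := by
  obtain ⟨P, hP, B, hB⟩ := h
  obtain ⟨P', hP', B', hB'⟩ := h'
  refine ⟨P + P', ?_, B + B', fun k => ?_⟩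
  · rw [map_add, add_sub_add_comm]
    exact Ideal.add_mem _ hP hP'
  · rw [map_add, Pi.add_apply, Pi.add_apply, add_sub_add_comm, add_mul]
    exact norm_add_le_of_le (hB k) (hB' k)

theorem Approx.neg {n : ℕ} {w : ℕ → L} {F : K⟦X⟧⟦X⟧} (h : Approx ι ξ υ n w F) :
    Approx ι ξ υ n (-w) (-F) := by
  obtain ⟨P, hP, B, hB⟩ := h
  refine ⟨-P, ?_, B, fun k => ?_⟩
  · rw [map_neg, neg_sub_neg, ← neg_sub]
    exact Submodule.neg_mem _ hP
  · rw [map_neg, Pi.neg_apply, Pi.neg_apply, neg_sub_neg, norm_sub_rev]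
    exact hB k

theorem Approx.sub {n : ℕ} {w w' : ℕ → L} {F F' : K⟦X⟧⟦X⟧} (h : Approx ι ξ υ n w F)
    (h' : Approx ι ξ υ n w' F') : Approx ι ξ υ n (w - w') (F - F') := by
  rw [sub_eq_add_neg, sub_eq_add_neg]
  exact h.add h'.neg

theorem Approx.mul (hξ : ‖ξ‖ ≤ 1) (hυ : ‖υ‖ ≤ ‖ξ‖) {n : ℕ} {w w' : ℕ → L} {F F' : K⟦X⟧⟦X⟧}
    (h : Approx ι ξ υ n w F) (h' : Approx ι ξ υ n w' F') :
    Approx ι ξ υ n (w * w') (F * F') := by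
  obtain ⟨A, hA⟩ : ∃ A, ∀ k, ‖w k‖ ≤ A := by
    obtain ⟨P, -, B, hB⟩ := h.anti hξ (Nat.zero_le n)
    obtain ⟨B', hB'⟩ := exists_norm_evalSeq_le (ι := ι) hξ hυ P
    refine ⟨B + B', fun k => ?_⟩
    rw [← sub_add_cancel (w k) (evalSeq ι ξ υ P k)]
    exact norm_add_le_of_le (by simpa using hB k) (hB' k)
  obtain ⟨P, hP, B, hB⟩ := h
  obtain ⟨P', hP', B', hB'⟩ := h'
  obtain ⟨A', hA'⟩ := exists_norm_evalSeq_le (ι := ι) hξ hυ P'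
  refine ⟨P * P', ?_, A * B' + B * A', fun k => ?_⟩
  · have e : F * F' - polyToSeries K (P * P') =
        F * (F' - polyToSeries K P') + (F - polyToSeries K P) * polyToSeries K P' := by
      rw [map_mul]; ring
    rw [e]
    exact Ideal.add_mem _ (Ideal.mul_mem_left _ _ hP') (Ideal.mul_mem_right _ _ hP)
  · have e : (w * w') k - evalSeq ι ξ υ (P * P') k =
        w k * (w' k - evalSeq ι ξ υ P' k) +
          (w k - evalSeq ι ξ υ P k) * evalSeq ι ξ υ P' k := by
      rw [map_mul, Pi.mul_apply, Pi.mul_apply]; ring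
    have hA0 := (norm_nonneg _).trans (hA k)
    have hB0 := (norm_nonneg _).trans (hB k)
    calc ‖(w * w') k - evalSeq ι ξ υ (P * P') k‖
        ≤ A * (B' * (‖ξ‖ ^ 9 ^ k) ^ n) + B * (‖ξ‖ ^ 9 ^ k) ^ n * A' := by
          rw [e]
          refine norm_add_le_of_le ?_ ?_ <;> rw [norm_mul]
          · exact mul_le_mul (hA k) (hB' k) (norm_nonneg _) hA0
          · exact mul_le_mul (hB k) (hA' k) (norm_nonneg _) hB0
      _ = (A * B' + B * A') * (‖ξ‖ ^ 9 ^ k) ^ n := by ring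

theorem Approx.shift {n : ℕ} {w : ℕ → L} {F : K⟦X⟧⟦X⟧} (h : Approx ι ξ υ n w F) :
    Approx ι ξ υ (9 * n) (fun k => w (k + 1)) (shift K F) := by
  obtain ⟨P, hP, B, hB⟩ := h
  refine ⟨polyShift K P, ?_, B, fun k => ?_⟩
  · rw [polyToSeries_polyShift, ← map_sub]
    exact shift_mem_boxIdeal hP
  · rw [evalSeq_polyShift, pow_mul, ← pow_mul _ (9 ^ k) 9, ← pow_succ]
    exact hB (k + 1)

theorem Approx.norm_le (hξ : ‖ξ‖ ≤ 1) (hυ : ‖υ‖ ≤ ‖ξ‖) {n : ℕ} {w : ℕ → L} {F : K⟦X⟧⟦X⟧}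
    (h : Approx ι ξ υ n w F) (hF : F ∈ boxIdeal K n) :
    ∃ B, ∀ k, ‖w k‖ ≤ B * (‖ξ‖ ^ 9 ^ k) ^ n := by
  obtain ⟨P, hP, B, hB⟩ := h
  have hP' : polyToSeries K P ∈ boxIdeal K n := by
    have := Ideal.sub_mem _ hF hP
    rwa [sub_sub_cancel] at this
  obtain ⟨B', hB'⟩ := norm_evalSeq_le (ι := ι) hξ hυ hP'
  refine ⟨B + B', fun k => ?_⟩
  rw [← sub_add_cancel (w k) (evalSeq ι ξ υ P k), add_mul]
  exact norm_add_le_of_le (hB k) (hB' k)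

theorem Approx.of_mul_eq (hξ : ‖ξ‖ ≤ 1) (hυ : ‖υ‖ ≤ ‖ξ‖) {n : ℕ} {w d z : ℕ → L}
    {F D G : K⟦X⟧⟦X⟧} (hw : Approx ι ξ υ n w F) (hd : Approx ι ξ υ n d D) {ε : ℝ} (hε : 0 < ε)
    (hεd : ∀ k, ε ≤ ‖d k‖) (hz : z * d = w) (hG : G * D = F) : Approx ι ξ υ n z G := by
  obtain ⟨P, hP⟩ := exists_sub_polyToSeries_mem n G
  have h1 := hw.sub ((approx_poly (ι := ι) (ξ := ξ) (υ := υ) n P).mul hξ hυ hd)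
  obtain ⟨B, hB⟩ := h1.norm_le hξ hυ (by
    rw [← hG, ← sub_mul]
    exact Ideal.mul_mem_right _ _ hP)
  refine ⟨P, hP, B / ε, fun k => ?_⟩
  have h2 := hB k
  rw [← hz, ← sub_mul, Pi.mul_apply, norm_mul, Pi.sub_apply] at h2
  rw [div_mul_eq_mul_div, le_div_iff₀ hε]
  exact (mul_le_mul_of_nonneg_left (hεd k) (norm_nonneg _)).trans h2

theorem Approx.eval₂ (hξ : ‖ξ‖ ≤ 1) (hυ : ‖υ‖ ≤ ‖ξ‖) {n : ℕ} {u : ℕ → L} {f : K⟦X⟧⟦X⟧}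
    (h : Approx ι ξ υ n u f) (P : K[X][X][X]) :
    Approx ι ξ υ n (P.eval₂ (evalSeq ι ξ υ) u) (P.eval₂ (polyToSeries K) f) := by
  induction P using Polynomial.induction_on with
  | C a => simpa using approx_poly n a
  | add P Q hP hQ => simpa using hP.add hQ
  | monomial m a ih =>
    have := ih.mul hξ hυ h
    simpa [pow_succ, mul_assoc] using this

/-- A sequence satisfying the functional equation along the points `(ξ ^ 9 ^ k, υ ^ 9 ^ k)` agrees
to every order with the series solution. -/
theorem IsMahlerSolution.approx {c s : K} {f : K⟦X⟧⟦X⟧} (hf : IsMahlerSolution c s f)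
    (hξ : ‖ξ‖ ≤ 1) (hυ : ‖υ‖ ≤ ‖ξ‖) {u : ℕ → L}
    {B : ℝ} (hB : ∀ k, ‖u k‖ ≤ B * ‖ξ‖ ^ 9 ^ k)
    (hu : ∀ k, (u k - ι c * ξ ^ 9 ^ k) * (u (k + 1) - ι s) =
      υ ^ 9 ^ k * (u k - ι s * ξ ^ 9 ^ k) * (u (k + 1) - ι c))
    {ε : ℝ} (hε : 0 < ε)
    (hεd : ∀ k, ε ≤ ‖(u (k + 1) - ι s) - υ ^ 9 ^ k * (u (k + 1) - ι c)‖) (n : ℕ) :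
    Approx ι ξ υ n u f := by
  suffices h : Approx ι ξ υ (n + 1) u f from h.anti hξ (Nat.le_succ n)
  induction n with
  | zero =>
    refine ⟨0, ?_, B, by simpa using hB⟩
    rw [map_zero, sub_zero, mem_boxIdeal_one]
    simpa using hf.coeff_zero
  | succ n ih =>
    have h1 := ih.shift.anti hξ (show n + 1 + 1 ≤ 9 * (n + 1) by omega)
    have hc (a : K) := approx_poly (ι := ι) (ξ := ξ) (υ := υ) (n + 1 + 1) (C (C a))
    have hx := approx_poly (ι := ι) (ξ := ξ) (υ := υ) (n + 1 + 1) (C X)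
    have hy := approx_poly (ι := ι) (ξ := ξ) (υ := υ) (n + 1 + 1) X
    have hd := (h1.sub (hc s)).sub (hy.mul hξ hυ (h1.sub (hc c)))
    have hw := hx.mul hξ hυ (((hc c).mul hξ hυ (h1.sub (hc s))).sub
      (((hc s).mul hξ hυ hy).mul hξ hυ (h1.sub (hc c))))
    refine hw.of_mul_eq hξ hυ hd hε (fun k => ?_) (funext fun k => ?_) ?_
    · simpa [evalSeq_C_C, evalSeq_X] using hεd k
    · simp only [Pi.mul_apply, Pi.sub_apply, evalSeq_C_C, evalSeq_X, evalSeq_C_X]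
      linear_combination hu k
    · simp only [polyToSeries_C_C, polyToSeries_C_X, polyToSeries_X]
      linear_combination hf.eq

end Approx

/-! ### The auxiliary polynomial -/

/-- A nonzero polynomial of degree less than `n` in each variable that vanishes to high order
at `(x, y, f)`. -/
theorem exists_auxiliary_polynomial (f : K⟦X⟧⟦X⟧) {n D : ℕ} (h : D ^ 2 < n ^ 3) :
    ∃ P : K[X][X][X], P ≠ 0 ∧ P.natDegree < n ∧ (∀ l, (P.coeff l).natDegree < n) ∧
      (∀ l j, ((P.coeff l).coeff j).natDegree < n) ∧
      P.eval₂ (polyToSeries K) f ∈ boxIdeal K D := by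
  have hn : 0 < n := Nat.pos_of_ne_zero (by rintro rfl; simp at h)
  let poly (c : Fin n × Fin n × Fin n → K) : K[X][X][X] :=
    ∑ t, monomial (t.2.2 : ℕ) (monomial (t.2.1 : ℕ) (monomial (t.1 : ℕ) (c t)))
  let series (t : Fin n × Fin n × Fin n) : K⟦X⟧⟦X⟧ :=
    varX ^ (t.1 : ℕ) * varY ^ (t.2.1 : ℕ) * f ^ (t.2.2 : ℕ)
  let Φ : (Fin n × Fin n × Fin n → K) →ₗ[K] (Fin D × Fin D → K) :=
    Matrix.mulVecLin (Matrix.of fun (e : Fin D × Fin D) t =>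
      PowerSeries.coeff (e.1 : ℕ) (PowerSeries.coeff (e.2 : ℕ) (series t)))
  have hker : LinearMap.ker Φ ≠ ⊥ := by
    apply LinearMap.ker_ne_bot_of_finrank_lt
    simp only [Module.finrank_fintype_fun_eq_card, Fintype.card_prod, Fintype.card_fin]
    convert h using 1 <;> ring
  obtain ⟨c, hc, hc0⟩ := (Submodule.ne_bot_iff _).1 hker
  have hcoeff (t : Fin n × Fin n × Fin n) :
      (((poly c).coeff t.2.2).coeff t.2.1).coeff t.1 = c t := by
    simp only [poly, finsetSum_coeff]
    rw [Finset.sum_eq_single t]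
    · simp
    · rintro ⟨i, j, l⟩ - hne
      simp only [coeff_monomial]
      by_cases hl : l = t.2.2 <;> by_cases hj : j = t.2.1 <;> by_cases hi : i = t.1 <;>
        simp_all [Fin.val_inj, coeff_monomial]
    · simp
  refine ⟨poly c, ?_, ?_, fun l => ?_, fun l j => ?_, ?_⟩
  · intro h0
    refine hc0 (funext fun t => ?_)
    rw [← hcoeff t, h0]
    simp
  · refine lt_of_le_of_lt (natDegree_sum_le_of_forall_le (n := n - 1) _ _ fun t _ => ?_)
      (Nat.sub_lt hn one_pos)
    exact (natDegree_monomial_le _).trans (by omega)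
  · rw [finsetSum_coeff]
    refine lt_of_le_of_lt (natDegree_sum_le_of_forall_le (n := n - 1) _ _ fun t _ => ?_)
      (Nat.sub_lt hn one_pos)
    rw [coeff_monomial]
    split_ifs
    · exact (natDegree_monomial_le _).trans (by omega)
    · simp
  · simp only [poly, finsetSum_coeff]
    refine lt_of_le_of_lt (natDegree_sum_le_of_forall_le (n := n - 1) _ _ fun t _ => ?_)
      (Nat.sub_lt hn one_pos)
    rw [coeff_monomial]
    split_ifs
    · rw [coeff_monomial]
      split_ifs
      · exact (natDegree_monomial_le _).trans (by omega)
      · simp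
    · simp
  · have hE : (poly c).eval₂ (polyToSeries K) f = ∑ t, cst (c t) * series t := by
      simp only [poly, eval₂_finsetSum, eval₂_monomial]
      refine Finset.sum_congr rfl fun t _ => ?_
      have : (monomial (t.2.1 : ℕ) (monomial (t.1 : ℕ) (c t)) : K[X][X]) =
          C (C (c t)) * C X ^ (t.1 : ℕ) * X ^ (t.2.1 : ℕ) := by
        rw [← C_mul_X_pow_eq_monomial, ← C_mul_X_pow_eq_monomial, C_mul, C_pow]
      rw [this, map_mul, map_mul, map_pow, map_pow, polyToSeries_C_C, polyToSeries_C_X,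
        polyToSeries_X]
      simp only [series]
      ring
    intro i hi j hj
    rw [hE, map_sum, map_sum]
    have := congrFun (LinearMap.mem_ker.1 hc) (⟨i, hi⟩, ⟨j, hj⟩)
    simp only [Φ, Matrix.mulVecLin_apply, Matrix.mulVec, dotProduct, Matrix.of_apply,
      Pi.zero_apply] at this
    rw [← this]
    refine Finset.sum_congr rfl fun t _ => ?_
    rw [cst, RingHom.comp_apply, PowerSeries.coeff_C_mul, PowerSeries.coeff_C_mul, mul_comm]

end FieldCoefficients

/-! ### Polynomials that are small at the points `η ^ 9 ^ k` -/

section Padic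

variable {p : ℕ} [Fact p.Prime]

theorem norm_pow_sub_one_le {η : ℚ_[p]} (h : ‖η - 1‖ ≤ 1) (i : ℕ) : ‖η ^ i - 1‖ ≤ ‖η - 1‖ := by
  have hη : ‖η‖ ≤ 1 := by
    rw [← sub_add_cancel η 1]
    exact (IsUltrametricDist.norm_add_le_max _ _).trans (max_le h (by simp))
  rw [← mul_geom_sum, norm_mul]
  refine mul_le_of_le_one_right (norm_nonneg _) ?_
  refine IsUltrametricDist.norm_sum_le_of_forall_le_of_nonneg zero_le_one fun j _ => ?_
  rw [norm_pow]
  exact pow_le_one₀ (norm_nonneg _) hη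

theorem norm_geom_sum_sub_le {η : ℚ_[p]} (h : ‖η - 1‖ ≤ 1) (n : ℕ) :
    ‖∑ i ∈ Finset.range n, η ^ i - n‖ ≤ ‖η - 1‖ := by
  have : (∑ i ∈ Finset.range n, η ^ i - n : ℚ_[p]) = ∑ i ∈ Finset.range n, (η ^ i - 1) := by
    simp
  rw [this]
  exact IsUltrametricDist.norm_sum_le_of_forall_le_of_nonneg (norm_nonneg _)
    fun i _ => norm_pow_sub_one_le h i

theorem norm_pow_sub_one_eq {η : ℚ_[p]} (h : ‖η - 1‖ ≤ 1) {n : ℕ} (hn : ‖η - 1‖ < ‖(n : ℚ_[p])‖) :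
    ‖η ^ n - 1‖ = ‖(n : ℚ_[p])‖ * ‖η - 1‖ := by
  rw [← geom_sum_mul, norm_mul]
  congr 1
  symm
  apply Padic.norm_eq_of_norm_sub_lt_left
  rw [norm_sub_rev]
  exact (norm_geom_sum_sub_le h n).trans_lt hn

theorem norm_pow_sub_one_ge {η : ℚ_[p]} (h : ‖η - 1‖ < ‖(p : ℚ_[p])‖) {n : ℕ} (hn : n ≠ 0) :
    ‖η - 1‖ / n ≤ ‖η ^ n - 1‖ := by
  have hp : p.Prime := Fact.out
  induction n using Nat.strong_induction_on generalizing η with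
  | _ n ih =>
    have h1 : ‖η - 1‖ ≤ 1 := h.le.trans Padic.norm_p_lt_one.le
    by_cases hpn : p ∣ n
    · obtain ⟨m, rfl⟩ := hpn
      have hm : m ≠ 0 := right_ne_zero_of_mul hn
      have e := norm_pow_sub_one_eq h1 h
      have h2 : ‖η ^ p - 1‖ < ‖(p : ℚ_[p])‖ := by
        rw [e]
        exact (mul_le_of_le_one_left (norm_nonneg _) Padic.norm_p_lt_one.le).trans_lt h
      have := ih m (lt_mul_of_one_lt_left (Nat.pos_of_ne_zero hm) hp.one_lt) h2 hm
      rw [e, Padic.norm_p] at this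
      rw [pow_mul]
      refine le_of_eq_of_le ?_ this
      push_cast
      field_simp
    · have hn1 : ‖(n : ℚ_[p])‖ = 1 :=
        Padic.norm_natCast_eq_one_iff.2 ((Nat.Prime.coprime_iff_not_dvd hp).2 hpn)
      rw [norm_pow_sub_one_eq h1 (by rw [hn1]; exact h.trans Padic.norm_p_lt_one), hn1, one_mul]
      exact div_le_self (norm_nonneg _) (by exact_mod_cast Nat.one_le_iff_ne_zero.2 hn)

theorem norm_eq_one_of_norm_sub_one_lt {η : ℚ_[p]} (h : ‖η - 1‖ < 1) : ‖η‖ = 1 := by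
  rw [← norm_one (α := ℚ_[p])]
  apply Padic.norm_eq_of_norm_sub_lt_right
  simpa using h

theorem norm_pow_sub_pow_ge {η : ℚ_[p]} (h : ‖η - 1‖ < ‖(p : ℚ_[p])‖) {m n N : ℕ} (hmn : m ≠ n)
    (hm : m ≤ N) (hn : n ≤ N) : ‖η - 1‖ / N ≤ ‖η ^ m - η ^ n‖ := by
  have hη := norm_eq_one_of_norm_sub_one_lt (h.trans Padic.norm_p_lt_one)
  wlog hlt : n < m generalizing m n
  · rw [norm_sub_rev (η ^ m)]
    exact this hmn.symm hn hm (by omega)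
  have e : η ^ m - η ^ n = η ^ n * (η ^ (m - n) - 1) := by
    rw [mul_sub, ← pow_add, mul_one, Nat.add_sub_cancel' hlt.le]
  rw [e, norm_mul, norm_pow, hη, one_pow, one_mul]
  refine le_trans ?_ (norm_pow_sub_one_ge h (Nat.sub_ne_zero_of_lt hlt))
  have : 0 < m - n := Nat.sub_pos_of_lt hlt
  gcongr
  omega

theorem eq_zero_of_norm_eval_le {η : ℚ_[p]} (h : ‖η - 1‖ < ‖(p : ℚ_[p])‖) (hη1 : η ≠ 1)
    {Q : ℚ_[p][X]} {θ : ℝ} (hθ0 : 0 < θ) (hθ : θ < 1) {B : ℝ} {k₀ : ℕ}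
    (hQ : ∀ k, k₀ ≤ k → ‖Q.eval (η ^ 9 ^ k)‖ ≤ B * θ ^ 9 ^ k) : Q = 0 := by
  have hη := norm_eq_one_of_norm_sub_one_lt (h.trans Padic.norm_p_lt_one)
  have hδ : 0 < ‖η - 1‖ := norm_pos_iff.2 (sub_ne_zero.2 hη1)
  have hB : 0 ≤ B := by
    have := (norm_nonneg _).trans (hQ k₀ le_rfl)
    by_contra! hB
    nlinarith [pow_pos hθ0 (9 ^ k₀)]
  suffices hroot : ∀ τ : ℕ, Q.eval (τ : ℚ_[p]) = 0 by
    refine eq_zero_of_infinite_isRoot Q (Set.Infinite.mono ?_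
      (Set.infinite_range_of_injective (Nat.cast_injective (R := ℚ_[p]))))
    rintro _ ⟨τ, rfl⟩
    exact hroot τ
  intro τ
  set d := Q.natDegree with hd
  have key (k : ℕ) (hk : k₀ ≤ k) :
      ‖Q.eval (τ : ℚ_[p])‖ ≤ B * (9 ^ d / ‖η - 1‖) ^ d * (((9 ^ k : ℕ) : ℝ) ^ d * θ ^ 9 ^ k) := by
    set t : ℕ → ℚ_[p] := fun i => η ^ 9 ^ (k + i) with ht
    have hdist {i j : ℕ} (hij : i ≠ j) (hi : i ≤ d) (hj : j ≤ d) :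
        ‖η - 1‖ / (9 ^ (k + d) : ℕ) ≤ ‖t i - t j‖ := by
      refine norm_pow_sub_pow_ge h ?_ ?_ ?_
      · exact fun e => hij (by simpa using Nat.pow_right_injective (show 2 ≤ 9 by norm_num) e)
      all_goals exact Nat.pow_le_pow_right (by norm_num) (by omega)
    have hinj : Set.InjOn t (Finset.range (d + 1)) := by
      intro i hi j hj hij
      by_contra hne
      have := hdist hne (by simpa [Nat.lt_succ_iff] using hi) (by simpa [Nat.lt_succ_iff] using hj)
      rw [hij, sub_self, norm_zero] at this
      exact absurd this (not_le.2 (by positivity))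
    have hinterp := Lagrange.eq_interpolate (f := Q) hinj
      (by rw [Finset.card_range]; exact degree_le_natDegree.trans_lt (by exact_mod_cast d.lt_succ_self))
    rw [hinterp, Lagrange.interpolate_apply, eval_finsetSum]
    refine IsUltrametricDist.norm_sum_le_of_forall_le_of_nonneg (by positivity) fun i hi => ?_
    rw [eval_mul, eval_C, norm_mul, Lagrange.basis, eval_prod, norm_prod]
    have h1 : ‖Q.eval (t i)‖ ≤ B * θ ^ 9 ^ k := by
      refine (hQ _ (hk.trans (Nat.le_add_right k i))).trans ?_
      exact mul_le_mul_of_nonneg_left (pow_le_pow_of_le_one hθ0.le hθ.le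
        (Nat.pow_le_pow_right (by norm_num) (Nat.le_add_right k i))) hB
    have h2 : ∏ j ∈ (Finset.range (d + 1)).erase i,
        ‖(Lagrange.basisDivisor (t i) (t j)).eval (τ : ℚ_[p])‖ ≤
        ((9 ^ (k + d) : ℕ) / ‖η - 1‖) ^ d := by
      have hcard : ((Finset.range (d + 1)).erase i).card = d := by
        rw [Finset.card_erase_of_mem hi, Finset.card_range, Nat.add_sub_cancel]
      calc _ ≤ ∏ j ∈ (Finset.range (d + 1)).erase i, ((9 ^ (k + d) : ℕ) / ‖η - 1‖ : ℝ) := by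
            refine Finset.prod_le_prod (fun _ _ => norm_nonneg _) fun j hj => ?_
            rw [Finset.mem_erase, Finset.mem_range] at hj
            rw [Finset.mem_range] at hi
            rw [Lagrange.basisDivisor, eval_mul, eval_C, norm_mul, norm_inv, eval_sub, eval_X,
              eval_C]
            have hle : ‖(τ : ℚ_[p]) - t j‖ ≤ 1 := by
              rw [sub_eq_add_neg]
              refine (IsUltrametricDist.norm_add_le_max _ _).trans (max_le ?_ ?_)
              · exact_mod_cast Padic.norm_int_le_one (p := p) τ
              · simp [ht, hη]
            refine (mul_le_of_le_one_right (by positivity) hle).trans ?_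
            rw [← inv_div]
            exact inv_anti₀ (by positivity) (hdist hj.1.symm (by omega) (by omega))
        _ = _ := by rw [Finset.prod_const, hcard]
    calc _ ≤ B * θ ^ 9 ^ k * ((9 ^ (k + d) : ℕ) / ‖η - 1‖) ^ d :=
          mul_le_mul h1 h2 (by positivity) (by positivity)
      _ = _ := by
        push_cast
        rw [pow_add]
        ring
  have hlim : Tendsto (fun k : ℕ => B * (9 ^ d / ‖η - 1‖) ^ d *
      (((9 ^ k : ℕ) : ℝ) ^ d * θ ^ 9 ^ k)) atTop (nhds 0) := by
    have := ((tendsto_pow_const_mul_const_pow_of_abs_lt_one d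
      (by rwa [abs_of_pos hθ0])).comp
        (tendsto_pow_atTop_atTop_of_one_lt (r := 9) (by norm_num))).const_mul
          (B * (9 ^ d / ‖η - 1‖) ^ d)
    simpa using this
  have := ge_of_tendsto hlim (eventually_atTop.2 ⟨k₀, key⟩)
  exact norm_le_zero_iff.1 this

end Padic

section AuxiliaryPolynomial

variable {K : Type*} [Field K]

/-- A sequence that agrees to every order with a nonzero series does not vanish eventually. -/
theorem exists_ne_zero_of_approx {p : ℕ} [Fact p.Prime] {ι : K →+* ℚ_[p]} {ξ υ η : ℚ_[p]}
    (hξ0 : ξ ≠ 0) (hξ : ‖ξ‖ < 1) (hυ : υ = η * ξ ^ 3) (hη : ‖η - 1‖ < ‖(p : ℚ_[p])‖) (hη1 : η ≠ 1)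
    {E : K⟦X⟧⟦X⟧} (hE : E ≠ 0) {w : ℕ → ℚ_[p]} (hw : ∀ n, Approx ι ξ υ n w E) (k₀ : ℕ) :
    ∃ k, k₀ ≤ k ∧ w k ≠ 0 := by
  have hηn := norm_eq_one_of_norm_sub_one_lt (hη.trans Padic.norm_p_lt_one)
  by_contra! hzero
  have hex : ∃ D i j, i + 3 * j = D ∧ PowerSeries.coeff i (PowerSeries.coeff j E) ≠ 0 := by
    by_contra! h
    refine hE ?_
    ext j i
    simpa using h _ i j rfl
  classical
  obtain ⟨D, ⟨i₀, j₀, hD, hne⟩, hmin⟩ : ∃ D, (∃ i j, i + 3 * j = D ∧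
      PowerSeries.coeff i (PowerSeries.coeff j E) ≠ 0) ∧
      ∀ i j, i + 3 * j < D → PowerSeries.coeff i (PowerSeries.coeff j E) = 0 := by
    refine ⟨Nat.find hex, Nat.find_spec hex, fun i j h => ?_⟩
    by_contra hne
    exact Nat.find_min hex h ⟨i, j, rfl, hne⟩
  obtain ⟨P, hP, B, hB⟩ := hw (D + 1)
  have hPE {i j : ℕ} (h : i + 3 * j ≤ D) :
      (P.coeff j).coeff i = PowerSeries.coeff i (PowerSeries.coeff j E) := by
    have := hP i (by omega) j (by omega)
    rw [map_sub, map_sub, coeff_polyToSeries, Polynomial.coeff_coe] at this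
    exact (sub_eq_zero.1 this).symm
  set Q : ℚ_[p][X] := ∑ j ∈ P.support, ∑ i ∈ (P.coeff j).support,
    if i + 3 * j = D then monomial j (ι ((P.coeff j).coeff i)) else 0 with hQdef
  have hQ0 : Q ≠ 0 := by
    intro h
    have := congrArg (fun q => q.coeff j₀) h
    simp only [hQdef, finsetSum_coeff, coeff_zero] at this
    rw [Finset.sum_eq_single j₀, Finset.sum_eq_single i₀, if_pos hD, coeff_monomial, if_pos rfl,
      map_eq_zero, hPE hD.le] at this
    · exact hne this
    · intro i _ hi
      rw [if_neg (by omega), coeff_zero]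
    · intro hi
      rw [if_pos hD, coeff_monomial, if_pos rfl, notMem_support_iff.1 hi, map_zero]
    · intro j _ hj
      refine Finset.sum_eq_zero fun i _ => ?_
      split_ifs
      · rw [coeff_monomial, if_neg hj]
      · rw [coeff_zero]
    · intro hj
      simp [notMem_support_iff.1 hj]
  refine hQ0 (eq_zero_of_norm_eval_le hη hη1 (norm_pos_iff.2 hξ0) hξ
    (B := ∑ j ∈ P.support, ∑ i ∈ (P.coeff j).support, ‖ι ((P.coeff j).coeff i)‖ + B)
    (k₀ := k₀) fun k hk => ?_)
  set x := ξ ^ 9 ^ k with hx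
  have hx0 : x ≠ 0 := pow_ne_zero _ hξ0
  have hxn : ‖x‖ = ‖ξ‖ ^ 9 ^ k := norm_pow _ _
  have hx1 : ‖x‖ ≤ 1 := hxn ▸ pow_le_one₀ (norm_nonneg _) hξ.le
  have hy : υ ^ 9 ^ k = η ^ 9 ^ k * x ^ 3 := by rw [hυ, mul_pow, hx, pow_right_comm]
  have h1 : ‖evalSeq ι ξ υ P k - x ^ D * Q.eval (η ^ 9 ^ k)‖ ≤
      (∑ j ∈ P.support, ∑ i ∈ (P.coeff j).support, ‖ι ((P.coeff j).coeff i)‖) *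
        ‖x‖ ^ (D + 1) := by
    rw [evalSeq_eq_sum, hQdef, eval_finsetSum, Finset.mul_sum, ← Finset.sum_sub_distrib,
      Finset.sum_mul]
    refine norm_sum_le_of_le _ fun j _ => ?_
    rw [eval_finsetSum, Finset.mul_sum, ← Finset.sum_sub_distrib, Finset.sum_mul]
    refine norm_sum_le_of_le _ fun i hi => ?_
    rw [← hx, hy]
    split_ifs with hij
    · rw [eval_monomial, ← hij]
      refine le_of_eq_of_le ?_ (by positivity : 0 ≤ ‖ι ((P.coeff j).coeff i)‖ * ‖x‖ ^ (i + 3 * j + 1))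
      rw [norm_eq_zero]
      ring
    · have hlt : D + 1 ≤ i + 3 * j := by
        by_contra! hlt
        refine mem_support_iff.1 hi ?_
        rw [hPE (by omega)]
        exact hmin i j (by omega)
      rw [eval_zero, mul_zero, sub_zero, mul_assoc, norm_mul]
      refine mul_le_mul_of_nonneg_left ?_ (norm_nonneg _)
      have e : x ^ i * (η ^ 9 ^ k * x ^ 3) ^ j = (η ^ 9 ^ k) ^ j * x ^ (i + 3 * j) := by ring
      rw [e, norm_mul, norm_pow, norm_pow, norm_pow, hηn, one_pow, one_pow, one_mul]
      exact pow_le_pow_of_le_one (norm_nonneg _) hx1 hlt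
  have h2 := hB k
  rw [hzero k hk, zero_sub, norm_neg, ← hxn] at h2
  have h3 : ‖x ^ D * Q.eval (η ^ 9 ^ k)‖ ≤
      (∑ j ∈ P.support, ∑ i ∈ (P.coeff j).support, ‖ι ((P.coeff j).coeff i)‖ + B) *
        ‖x‖ ^ (D + 1) := by
    rw [add_mul, ← sub_sub_cancel (evalSeq ι ξ υ P k) (x ^ D * _), sub_eq_neg_add]
    refine norm_add_le_of_le ?_ h2
    rwa [norm_neg]
  rw [norm_mul, norm_pow, pow_succ, ← mul_assoc, mul_right_comm, mul_comm] at h3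
  rw [← hxn]
  exact le_of_mul_le_mul_right h3 (pow_pos (norm_pos_iff.2 hx0) D)

end AuxiliaryPolynomial

/-! ### Liouville's inequality -/

section Liouville

variable {p : ℕ} [Fact p.Prime]

theorem one_le_mul_norm_natCast {n : ℕ} (hn : n ≠ 0) : 1 ≤ (n : ℝ) * ‖(n : ℚ_[p])‖ := by
  have hp : p.Prime := Fact.out
  rw [Padic.norm_eq_zpow_neg_valuation (Nat.cast_ne_zero.2 hn), Padic.valuation_natCast, zpow_neg,
    zpow_natCast, ← div_eq_mul_inv, one_le_div (pow_pos (by exact_mod_cast hp.pos) _)]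
  exact_mod_cast Nat.le_of_dvd (Nat.pos_of_ne_zero hn) pow_padicValNat_dvd

variable {K : Type*} [Field K]

theorem norm_le_one_of_isIntegral (ι : K →+* ℚ_[p]) {z : K} (hz : IsIntegral ℤ z) :
    ‖ι z‖ ≤ 1 := by
  have h1 : IsIntegral ℤ (ι z) := hz.map (ι.toIntAlgHom)
  have h2 : IsIntegral ℤ_[p] (ι z) := h1.tower_top
  obtain ⟨y, hy⟩ := IsIntegrallyClosed.isIntegral_iff.1 h2
  rw [← hy]
  exact y.norm_le_one

/-- A nonzero algebraic integer cannot be too small `p`-adically. -/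
theorem one_le_norm_mul_pow [NumberField K] (ι : K →+* ℚ_[p]) {z : K} (hz : IsIntegral ℤ z)
    (hz0 : z ≠ 0) {H : ℝ} (hH : ∀ σ : K →+* ℂ, ‖σ z‖ ≤ H) :
    1 ≤ ‖ι z‖ * H ^ Module.finrank ℚ K := by
  set w : NumberField.RingOfIntegers K := ⟨z, hz⟩ with hw
  set n := Ideal.absNorm (Ideal.span {w}) with hn
  have hw0 : w ≠ 0 := fun h => hz0 (congrArg Subtype.val h)
  have hn0 : n ≠ 0 := by
    rw [hn, Ne, Ideal.absNorm_eq_zero_iff, Ideal.span_singleton_eq_bot]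
    exact hw0
  obtain ⟨t, ht⟩ : w ∣ n := Ideal.mem_span_singleton.1 (Ideal.absNorm_mem _)
  have ht' : (n : K) = z * (t : K) := by
    have := congrArg (algebraMap (NumberField.RingOfIntegers K) K) ht
    rw [map_natCast, map_mul] at this
    exact this
  have h1 : ‖(n : ℚ_[p])‖ ≤ ‖ι z‖ := by
    have := congrArg ι ht'
    rw [map_natCast, map_mul] at this
    rw [this, norm_mul]
    exact mul_le_of_le_one_right (norm_nonneg _)
      (norm_le_one_of_isIntegral ι (NumberField.RingOfIntegers.isIntegral_coe t))
  have h2 : (n : ℝ) ≤ H ^ Module.finrank ℚ K := by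
    have e : (n : ℝ) = ‖algebraMap ℚ ℂ (Algebra.norm ℚ z)‖ := by
      rw [hn, Ideal.absNorm_span_singleton]
      have : (Algebra.norm ℤ w : ℚ) = Algebra.norm ℚ z := Algebra.coe_norm_int w
      rw [← this]
      simp [Nat.cast_natAbs]
    rw [e, Algebra.norm_eq_prod_embeddings ℚ ℂ, norm_prod]
    refine (Finset.prod_le_prod (fun _ _ => norm_nonneg _) fun (σ : K →ₐ[ℚ] ℂ) _ =>
      hH σ.toRingHom).trans_eq ?_
    rw [Finset.prod_const, Finset.card_univ, AlgHom.card]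
  have h3 := one_le_mul_norm_natCast (p := p) hn0
  calc (1 : ℝ) ≤ n * ‖(n : ℚ_[p])‖ := h3
    _ ≤ H ^ Module.finrank ℚ K * ‖ι z‖ :=
      mul_le_mul h2 h1 (norm_nonneg _) ((Nat.cast_nonneg n).trans h2)
    _ = _ := mul_comm _ _

end Liouville

/-! ### Exponentially bounded sequences and the transcendence argument -/

section Tame

variable {K : Type*} [Field K]

/-- The denominators and the archimedean absolute values of `z k` grow at most like
`q ^ 9 ^ k` and `A ^ 9 ^ k`. -/
structure TameBy (q : ℕ) (A : ℝ) (z : ℕ → K) : Prop where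
  isIntegral : ∀ k, IsIntegral ℤ ((q : K) ^ 9 ^ k * z k)
  norm_le : ∀ (k : ℕ) (σ : K →+* ℂ), ‖σ (z k)‖ ≤ A ^ 9 ^ k

theorem TameBy.mono {q q' : ℕ} {A A' : ℝ} {z : ℕ → K} (h : TameBy q A z) (hq : q ∣ q')
    (hA0 : 0 ≤ A) (hA : A ≤ A') : TameBy q' A' z := by
  refine ⟨fun k => ?_, fun k σ => (h.norm_le k σ).trans (pow_le_pow_left₀ hA0 hA _)⟩
  obtain ⟨r, rfl⟩ := hq
  have e : ((q * r : ℕ) : K) ^ 9 ^ k * z k = (r : K) ^ 9 ^ k * ((q : K) ^ 9 ^ k * z k) := by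
    push_cast
    ring
  rw [e]
  exact ((isIntegral_natCast (R := ℤ) r).pow _).mul (h.isIntegral k)

/-- The denominators and the archimedean absolute values of `z k` grow at most
exponentially in `9 ^ k`. -/
def Tame (z : ℕ → K) : Prop := ∃ q : ℕ, q ≠ 0 ∧ ∃ A : ℝ, 1 ≤ A ∧ TameBy q A z

theorem Tame.exists_common {x y a b : ℕ → K} (hx : Tame x) (hy : Tame y) (ha : Tame a)
    (hb : Tame b) : ∃ q : ℕ, q ≠ 0 ∧ ∃ A : ℝ, 1 ≤ A ∧
      TameBy q A x ∧ TameBy q A y ∧ TameBy q A a ∧ TameBy q A b := by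
  obtain ⟨q₁, h₁, A₁, hA₁, hx⟩ := hx
  obtain ⟨q₂, h₂, A₂, hA₂, hy⟩ := hy
  obtain ⟨q₃, h₃, A₃, hA₃, ha⟩ := ha
  obtain ⟨q₄, h₄, A₄, hA₄, hb⟩ := hb
  refine ⟨q₁ * q₂ * q₃ * q₄, by positivity, max (max A₁ A₂) (max A₃ A₄), by simp [hA₁],
    hx.mono ⟨q₂ * q₃ * q₄, by ring⟩ (by linarith) (by simp),
    hy.mono ⟨q₁ * q₃ * q₄, by ring⟩ (by linarith) (by simp),
    ha.mono ⟨q₁ * q₂ * q₄, by ring⟩ (by linarith) (by simp),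
    hb.mono ⟨q₁ * q₂ * q₃, by ring⟩ (by linarith) (by simp)⟩

theorem exists_pow_mul_pow_lt_one {θ T : ℝ} (hθ0 : 0 < θ) (hθ : θ < 1) (hT : 1 ≤ T) :
    ∃ N D : ℕ, D ^ 2 < (N + 1) ^ 3 ∧ θ ^ D * T ^ N < 1 := by
  obtain ⟨m, hm⟩ : ∃ m, θ ^ m * T < 1 := by
    have := (tendsto_pow_atTop_nhds_zero_of_lt_one hθ0.le hθ).mul_const T
    rw [zero_mul] at this
    exact (this.eventually_lt_const one_pos).exists
  obtain ⟨n, hn⟩ : ∃ n, n = m + 2 := ⟨_, rfl⟩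
  have hn' : θ ^ n * T < 1 := by
    refine lt_of_le_of_lt ?_ hm
    exact mul_le_mul_of_nonneg_right (pow_le_pow_of_le_one hθ0.le hθ.le (by omega)) (by linarith)
  have hn2 : 2 ^ 2 ≤ n ^ 2 := Nat.pow_le_pow_left (by omega) 2
  refine ⟨n ^ 2 - 1, n * (n ^ 2 - 1), ?_, ?_⟩
  · rw [Nat.sub_add_cancel (by omega)]
    have h1 : n * (n ^ 2 - 1) < n * n ^ 2 :=
      Nat.mul_lt_mul_of_pos_left (by omega) (by omega)
    calc (n * (n ^ 2 - 1)) ^ 2 < (n * n ^ 2) ^ 2 := Nat.pow_lt_pow_left h1 (by norm_num)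
      _ = (n ^ 2) ^ 3 := by ring
  · rw [pow_mul, ← mul_pow]
    exact pow_lt_one₀ (by positivity) hn' (by omega)

/-- The homogenization in the last variable of `P(x, y, a / b)`. -/
noncomputable def homEval (P : K[X][X][X]) (N : ℕ) (x y a b : K) : K :=
  ∑ l ∈ Finset.range (N + 1), ∑ j ∈ Finset.range (N + 1), ∑ i ∈ Finset.range (N + 1),
    ((P.coeff l).coeff j).coeff i * x ^ i * y ^ j * (a ^ l * b ^ (N - l))

theorem map_homEval {L : Type*} [NormedField L] {ι : K →+* L} {ξ υ : K} {N : ℕ} {P : K[X][X][X]}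
    (h₁ : P.natDegree < N + 1) (h₂ : ∀ l, (P.coeff l).natDegree < N + 1)
    (h₃ : ∀ l j, ((P.coeff l).coeff j).natDegree < N + 1) {a b : ℕ → K} {k : ℕ} (hb : b k ≠ 0) :
    ι (homEval P N (ξ ^ 9 ^ k) (υ ^ 9 ^ k) (a k) (b k)) =
      ι (b k) ^ N * P.eval₂ (evalSeq ι (ι ξ) (ι υ)) (fun k => ι (a k / b k)) k := by
  rw [eval₂_eq_sum_range' _ h₁, Finset.sum_apply, homEval, map_sum, Finset.mul_sum]
  refine Finset.sum_congr rfl fun l hl => ?_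
  rw [Pi.mul_apply, Pi.pow_apply, evalSeq_apply, eval₂_eq_sum_range' _ (h₂ l), map_sum,
    Finset.sum_mul, Finset.mul_sum]
  refine Finset.sum_congr rfl fun j hj => ?_
  rw [coe_eval₂RingHom, eval₂_eq_sum_range' _ (h₃ l j), map_sum, Finset.sum_mul,
    Finset.sum_mul, Finset.mul_sum]
  refine Finset.sum_congr rfl fun i hi => ?_
  have hb' : ι (b k) ≠ 0 := by simpa using hb
  have hl' : l ≤ N := Nat.lt_succ_iff.1 (Finset.mem_range.1 hl)
  have e : ι (b k) ^ N = ι (b k) ^ l * ι (b k) ^ (N - l) := by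
    rw [← pow_add, Nat.add_sub_cancel' hl']
  simp only [map_mul, map_pow, map_div₀, e, div_pow]
  field_simp

theorem isIntegral_homEval {q N : ℕ} {P : K[X][X][X]} {m : ℤ}
    (hm : ∀ l < N + 1, ∀ j < N + 1, ∀ i < N + 1,
      IsIntegral ℤ (m * ((P.coeff l).coeff j).coeff i : K))
    {x y a b Q : K} (hQ : Q = (q : K)) (hx : IsIntegral ℤ (Q * x)) (hy : IsIntegral ℤ (Q * y))
    (ha : IsIntegral ℤ (Q * a)) (hb : IsIntegral ℤ (Q * b)) :
    IsIntegral ℤ (m * Q ^ (3 * N) * homEval P N x y a b) := by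
  rw [homEval, Finset.mul_sum]
  refine IsIntegral.sum _ fun l hl => ?_
  rw [Finset.mul_sum]
  refine IsIntegral.sum _ fun j hj => ?_
  rw [Finset.mul_sum]
  refine IsIntegral.sum _ fun i hi => ?_
  rw [Finset.mem_range] at hl hj hi
  have hQi : IsIntegral ℤ Q := hQ ▸ isIntegral_natCast (R := ℤ) q
  have e : m * Q ^ (3 * N) * (((P.coeff l).coeff j).coeff i * x ^ i * y ^ j *
      (a ^ l * b ^ (N - l))) =
      (m * ((P.coeff l).coeff j).coeff i) * (Q * x) ^ i * (Q * y) ^ j * (Q * a) ^ l *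
        (Q * b) ^ (N - l) * Q ^ (2 * N - i - j) := by
    have e1 : Q ^ (3 * N) = Q ^ i * Q ^ j * Q ^ l * Q ^ (N - l) * Q ^ (2 * N - i - j) := by
      simp only [← pow_add]
      congr 1
      omega
    rw [e1]
    ring
  rw [e]
  exact (((((hm l hl j hj i hi).mul (hx.pow i)).mul (hy.pow j)).mul (ha.pow l)).mul
    (hb.pow _)).mul (hQi.pow _)

theorem norm_homEval_le (P : K[X][X][X]) (N : ℕ) (σ : K →+* ℂ) :
    ∃ S : ℝ, ∀ (x y a b : K) (A : ℝ), 1 ≤ A → ‖σ x‖ ≤ A → ‖σ y‖ ≤ A → ‖σ a‖ ≤ A → ‖σ b‖ ≤ A →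
      ‖σ (homEval P N x y a b)‖ ≤ S * A ^ (3 * N) := by
  refine ⟨∑ l ∈ Finset.range (N + 1), ∑ j ∈ Finset.range (N + 1), ∑ i ∈ Finset.range (N + 1),
    ‖σ (((P.coeff l).coeff j).coeff i)‖, fun x y a b A hA hx hy ha hb => ?_⟩
  rw [homEval, map_sum, Finset.sum_mul]
  refine norm_sum_le_of_le _ fun l hl => ?_
  rw [map_sum, Finset.sum_mul]
  refine norm_sum_le_of_le _ fun j hj => ?_
  rw [map_sum, Finset.sum_mul]
  refine norm_sum_le_of_le _ fun i hi => ?_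
  rw [Finset.mem_range] at hl hj hi
  simp only [map_mul, map_pow, norm_mul, norm_pow, mul_assoc]
  refine mul_le_mul_of_nonneg_left ?_ (norm_nonneg _)
  have hA0 : 0 ≤ A := by linarith
  calc ‖σ x‖ ^ i * (‖σ y‖ ^ j * (‖σ a‖ ^ l * ‖σ b‖ ^ (N - l)))
      ≤ A ^ i * (A ^ j * (A ^ l * A ^ (N - l))) := by gcongr
    _ = A ^ (i + (j + (l + (N - l)))) := by simp only [pow_add]
    _ ≤ A ^ (3 * N) := pow_le_pow_right₀ hA (by omega)

/-- Mahler's method: a sequence of elements of a number field that satisfies the functional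
equation along the points `(ξ ^ 9 ^ k, υ ^ 9 ^ k)` cannot be exponentially bounded. -/
theorem false_of_tame [NumberField K] {p : ℕ} [Fact p.Prime] (ι : K →+* ℚ_[p]) {c s ξ υ η : K}
    (hc : c ≠ 0) (hs : s ≠ 0) (hcs : ∀ n, n ≠ 0 → (s / c) ^ n ≠ 1) (hξ0 : ξ ≠ 0)
    (hξ : ‖ι ξ‖ < 1) (hυ : υ = η * ξ ^ 3) (hη : ‖ι η - 1‖ < ‖(p : ℚ_[p])‖) (hη1 : η ≠ 1)
    {a b : ℕ → K} (hb0 : ∀ k, b k ≠ 0) {B : ℝ} (hB : ∀ k, ‖ι (a k / b k)‖ ≤ B * ‖ι ξ‖ ^ 9 ^ k)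
    (hu : ∀ k, (a k / b k - c * ξ ^ 9 ^ k) * (a (k + 1) / b (k + 1) - s) =
      υ ^ 9 ^ k * (a k / b k - s * ξ ^ 9 ^ k) * (a (k + 1) / b (k + 1) - c))
    {ε : ℝ} (hε : 0 < ε)
    (hεd : ∀ k, ε ≤ ‖ι ((a (k + 1) / b (k + 1) - s) - υ ^ 9 ^ k * (a (k + 1) / b (k + 1) - c))‖)
    (hx : Tame fun k => ξ ^ 9 ^ k) (hy : Tame fun k => υ ^ 9 ^ k) (ha : Tame a) (hb : Tame b) :
    False := by
  have hξ0' : ι ξ ≠ 0 := by simpa using hξ0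
  have hυ' : ι υ = ι η * ι ξ ^ 3 := by rw [hυ, map_mul, map_pow]
  have hη1' : ι η ≠ 1 := by rwa [Ne, map_eq_one_iff _ ι.injective]
  have hυξ : ‖ι υ‖ ≤ ‖ι ξ‖ := by
    rw [hυ', norm_mul, norm_eq_one_of_norm_sub_one_lt (hη.trans Padic.norm_p_lt_one), one_mul,
      norm_pow]
    exact pow_le_of_le_one (norm_nonneg _) hξ.le (by norm_num)
  obtain ⟨f, hf⟩ := exists_isMahlerSolution c hs
  have hfu (n : ℕ) : Approx ι (ι ξ) (ι υ) n (fun k => ι (a k / b k)) f := by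
    refine hf.approx hξ.le hυξ hB (fun k => ?_) hε (fun k => ?_) n
    · simpa only [map_mul, map_sub, map_pow] using congrArg ι (hu k)
    · simpa only [map_mul, map_sub, map_pow] using hεd k
  obtain ⟨q, hq0, A, hA, hx, hy, ha, hb⟩ := hx.exists_common hy ha hb
  set d := Module.finrank ℚ K with hd
  have hqA : 1 ≤ (q * A : ℝ) := by
    have : (1 : ℝ) ≤ q := by exact_mod_cast Nat.one_le_iff_ne_zero.2 hq0
    nlinarith
  obtain ⟨N, D, hND, hlt⟩ := exists_pow_mul_pow_lt_one (norm_pos_iff.2 hξ0') hξ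
    (one_le_pow₀ (n := 3 * d) hqA)
  obtain ⟨P, hP0, h₁, h₂, h₃, hPD⟩ := exists_auxiliary_polynomial f hND
  have hE0 := hf.eval₂_ne_zero hc hs hcs hP0
  have hE (n : ℕ) := (hfu n).eval₂ hξ.le hυξ P
  obtain ⟨B', hB'⟩ := (hE D).norm_le hξ.le hυξ hPD
  obtain ⟨m, hm0, hm⟩ : ∃ m : ℤ, m ≠ 0 ∧ ∀ l < N + 1, ∀ j < N + 1, ∀ i < N + 1,
      IsIntegral ℤ (m * ((P.coeff l).coeff j).coeff i : K) := by
    classical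
    obtain ⟨m, hm0, hm⟩ := exists_integral_multiples ℤ ℚ
      ((Finset.range (N + 1) ×ˢ Finset.range (N + 1) ×ˢ Finset.range (N + 1)).image
        fun t => ((P.coeff t.1).coeff t.2.1).coeff t.2.2)
    refine ⟨m, hm0, fun l hl j hj i hi => ?_⟩
    rw [← zsmul_eq_mul]
    refine hm _ (Finset.mem_image.2 ⟨(l, j, i), ?_, rfl⟩)
    simp [hl, hj, hi]
  obtain ⟨S, hS0, hS⟩ : ∃ S : ℝ, 0 ≤ S ∧ ∀ (σ : K →+* ℂ) (x y a b : K) (A : ℝ), 1 ≤ A →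
      ‖σ x‖ ≤ A → ‖σ y‖ ≤ A → ‖σ a‖ ≤ A → ‖σ b‖ ≤ A →
      ‖σ (homEval P N x y a b)‖ ≤ S * A ^ (3 * N) := by
    choose S hS using norm_homEval_le P N
    refine ⟨∑ σ : K →+* ℂ, |S σ|, Finset.sum_nonneg fun _ _ => abs_nonneg _,
      fun σ x y a b A hA hx hy ha hb => (hS σ x y a b A hA hx hy ha hb).trans ?_⟩
    refine mul_le_mul_of_nonneg_right ?_ (by positivity)
    exact (le_abs_self _).trans (Finset.single_le_sum (f := fun σ => |S σ|)
      (fun _ _ => abs_nonneg _) (Finset.mem_univ σ))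
  set ρ : ℝ := ‖ι ξ‖ ^ D * ((q * A) ^ (3 * d)) ^ N with hρ
  have hlower (k : ℕ) (hk : P.eval₂ (evalSeq ι (ι ξ) (ι υ)) (fun k => ι (a k / b k)) k ≠ 0) :
      1 ≤ B' * (|(m : ℝ)| * S) ^ d * ρ ^ 9 ^ k := by
    set E := P.eval₂ (evalSeq ι (ι ξ) (ι υ)) (fun k => ι (a k / b k)) k with hEdef
    have hmap := map_homEval (ι := ι) (ξ := ξ) (υ := υ) h₁ h₂ h₃ (a := a) (hb0 k)
    rw [← hEdef] at hmap
    set Z := homEval P N (ξ ^ 9 ^ k) (υ ^ 9 ^ k) (a k) (b k) with hZ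
    set W := (m : K) * ((q : K) ^ 9 ^ k) ^ (3 * N) * Z with hW
    have hZ0 : Z ≠ 0 := by
      intro h
      rw [h, map_zero] at hmap
      exact mul_ne_zero (pow_ne_zero _ (by simpa using hb0 k)) hk hmap.symm
    have hW0 : W ≠ 0 := by
      refine mul_ne_zero (mul_ne_zero (by exact_mod_cast hm0) (pow_ne_zero _ (pow_ne_zero _ ?_))) hZ0
      exact_mod_cast hq0
    have hWint : IsIntegral ℤ W :=
      isIntegral_homEval (q := q ^ 9 ^ k) hm (by push_cast; rfl) (hx.isIntegral k)
        (hy.isIntegral k) (ha.isIntegral k) (hb.isIntegral k)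
    have hWσ (σ : K →+* ℂ) : ‖σ W‖ ≤ |(m : ℝ)| * S * ((q * A) ^ 9 ^ k) ^ (3 * N) := by
      have h := hS σ _ _ _ _ (A ^ 9 ^ k) (one_le_pow₀ hA) (hx.norm_le k σ) (hy.norm_le k σ)
        (ha.norm_le k σ) (hb.norm_le k σ)
      rw [hW, map_mul, map_mul, map_pow, map_pow, map_intCast, map_natCast, norm_mul, norm_mul,
        norm_pow, norm_pow, Complex.norm_natCast, Complex.norm_intCast, mul_pow, mul_pow]
      calc |(m : ℝ)| * ((q : ℝ) ^ 9 ^ k) ^ (3 * N) * ‖σ Z‖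
          ≤ |(m : ℝ)| * ((q : ℝ) ^ 9 ^ k) ^ (3 * N) * (S * (A ^ 9 ^ k) ^ (3 * N)) := by gcongr
        _ = _ := by ring
    have hWι : ‖ι W‖ ≤ B' * (‖ι ξ‖ ^ 9 ^ k) ^ D := by
      refine le_trans ?_ (hB' k)
      have e : ι W = ι (m * ((q : K) ^ 9 ^ k) ^ (2 * N) * ((q : K) ^ 9 ^ k * b k) ^ N) * E := by
        have e3 : 3 * N = 2 * N + N := by ring
        rw [hW, map_mul, hmap, e3]
        simp only [map_mul, map_pow]
        ring
      rw [e, norm_mul]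
      refine mul_le_of_le_one_left (norm_nonneg _) (norm_le_one_of_isIntegral ι ?_)
      exact ((isIntegral_intCast (R := ℤ) m).mul (((isIntegral_natCast (R := ℤ) q).pow _).pow _)).mul
        ((hb.isIntegral k).pow _)
    refine (one_le_norm_mul_pow ι hWint hW0 hWσ).trans ((mul_le_mul_of_nonneg_right hWι
      (by positivity)).trans_eq ?_)
    rw [hρ, ← hd]
    ring
  have hlim := (((tendsto_pow_atTop_nhds_zero_of_lt_one (by positivity) hlt).comp
    (tendsto_pow_atTop_atTop_of_one_lt (r := 9) (by norm_num))).const_mul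
      (B' * (|(m : ℝ)| * S) ^ d))
  rw [mul_zero] at hlim
  obtain ⟨k₀, hk₀⟩ := eventually_atTop.1 (hlim.eventually_lt_const one_pos)
  obtain ⟨k, hk, hne⟩ := exists_ne_zero_of_approx hξ0' hξ hυ' hη hη1' hE0 hE k₀
  exact absurd (hlower k hne) (not_le.2 (hk₀ k hk))

end Tame

/-! ### Convergents of Ruban continued fractions -/

section Convergents

/-- The sequence with the recursion of the continued fraction of `a` and initial values `-1`, `x`,
that is, `rubanQ a n * x - rubanR a n` for `a 0 = 0`. -/
def remainder {K : Type*} [Field K] (a : ℕ → ℚ) (x : K) : ℕ → K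
  | 0 => -1
  | 1 => x
  | n + 2 => a (n + 1) * remainder a x (n + 1) + remainder a x n

theorem map_remainder {K L : Type*} [Field K] [Field L] (ι : K →+* L) (a : ℕ → ℚ) (x : K)
    (n : ℕ) : ι (remainder a x n) = remainder a (ι x) n := by
  induction n using Nat.twoStepInduction with
  | zero => simp [remainder]
  | one => simp [remainder]
  | more n h₁ h₂ => simp [remainder, h₁, h₂]

variable {p : ℕ} [Fact p.Prime] {a : ℕ → ℚ}

theorem remainder_eq (ha0 : a 0 = 0) (α : ℚ_[p]) (n : ℕ) :
    remainder a α n = (rubanQ a n : ℚ_[p]) * α - (rubanR a n : ℚ_[p]) := by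
  induction n using Nat.twoStepInduction with
  | zero => simp [remainder, rubanQ, rubanR]
  | one => simp [remainder, rubanQ, rubanR, ha0]
  | more n h₁ h₂ =>
    rw [remainder, h₁, h₂, rubanQ, rubanR]
    push_cast
    ring

theorem rubanR_mul_rubanQ_sub (a : ℕ → ℚ) (n : ℕ) :
    rubanR a (n + 1) * rubanQ a n - rubanR a n * rubanQ a (n + 1) = (-1) ^ (n + 1) := by
  induction n with
  | zero => simp [rubanQ, rubanR]
  | succ n ih =>
    rw [rubanQ, rubanR, pow_succ, ← ih]
    ring

theorem norm_rubanQ (ha : ∀ n, 1 ≤ n → ‖(a n : ℚ_[p])‖ = p) (n : ℕ) :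
    ‖(rubanQ a (n + 1) : ℚ_[p])‖ = (p : ℝ) ^ n ∧
      ‖(rubanQ a n : ℚ_[p])‖ < ‖(rubanQ a (n + 1) : ℚ_[p])‖ := by
  have hp : (1 : ℝ) < p := by exact_mod_cast (Fact.out : p.Prime).one_lt
  induction n with
  | zero => simp [rubanQ]
  | succ n ih =>
    obtain ⟨h₁, h₂⟩ := ih
    have h₃ : ‖(rubanQ a (n + 1 + 1) : ℚ_[p])‖ = (p : ℝ) ^ (n + 1) := by
      have h : ‖(rubanQ a n : ℚ_[p])‖ < ‖(a (n + 1) * rubanQ a (n + 1) : ℚ_[p])‖ := by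
        rw [norm_mul, ha _ (Nat.le_add_left 1 n)]
        exact h₂.trans_le (le_mul_of_one_le_left (norm_nonneg _) hp.le)
      rw [rubanQ, Rat.cast_add, Rat.cast_mul,
        IsUltrametricDist.norm_add_eq_max_of_norm_ne_norm h.ne', max_eq_left h.le, norm_mul,
        ha _ (Nat.le_add_left 1 n), h₁, pow_succ, mul_comm]
    exact ⟨h₃, by rw [h₁, h₃]; exact pow_lt_pow_right₀ hp n.lt_succ_self⟩

theorem norm_remainder (ha0 : a 0 = 0) (ha : ∀ n, 1 ≤ n → ‖(a n : ℚ_[p])‖ = p) {α : ℚ_[p]}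
    (hα : IsRubanValue p a α) (n : ℕ) : ‖remainder a α n‖ = ((p : ℝ) ^ n)⁻¹ := by
  have hp : (1 : ℝ) < p := by exact_mod_cast (Fact.out : p.Prime).one_lt
  have hp0 : (0 : ℝ) < p := by linarith
  have hQ0 (n : ℕ) : (rubanQ a (n + 1) : ℚ_[p]) ≠ 0 := by
    rw [← norm_pos_iff, (norm_rubanQ ha n).1]
    positivity
  set x : ℕ → ℚ_[p] := fun n => ((rubanR a (n + 1) / rubanQ a (n + 1) : ℚ) : ℚ_[p]) with hx
  have hdet (n : ℕ) : (rubanR a (n + 1) : ℚ_[p]) * rubanQ a n -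
      rubanR a n * rubanQ a (n + 1) = (-1) ^ (n + 1) := by
    exact_mod_cast congrArg (Rat.cast : ℚ → ℚ_[p]) (rubanR_mul_rubanQ_sub a n)
  have hstep (n : ℕ) : ‖x (n + 1) - x n‖ = ((p : ℝ) ^ (2 * n + 1))⁻¹ := by
    have e : x (n + 1) - x n = (-1) ^ (n + 2) / (rubanQ a (n + 2) * rubanQ a (n + 1)) := by
      simp only [hx, Rat.cast_div]
      have := hdet (n + 1)
      have h1 := hQ0 n
      have h2 := hQ0 (n + 1)
      rw [← this]
      field_simp
    rw [e, norm_div, norm_mul, norm_pow, norm_neg, norm_one, one_pow, (norm_rubanQ ha n).1,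
      (norm_rubanQ ha (n + 1)).1, ← pow_add, one_div]
    congr 2
    omega
  have hdiff (n m : ℕ) : ‖x (n + m) - x n‖ ≤ ((p : ℝ) ^ (2 * n + 1))⁻¹ := by
    induction m with
    | zero => simp
    | succ m ih =>
      rw [← sub_add_sub_cancel _ (x (n + m))]
      refine (IsUltrametricDist.norm_add_le_max _ _).trans (max_le ?_ ih)
      rw [← add_assoc, hstep]
      exact inv_anti₀ (by positivity) (pow_le_pow_right₀ hp.le (by omega))
  have hle (n : ℕ) : ‖remainder a α (n + 1)‖ ≤ ((p : ℝ) ^ (n + 1))⁻¹ := by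
    have h1 : ‖α - x n‖ ≤ ((p : ℝ) ^ (2 * n + 1))⁻¹ := by
      have hlim : Tendsto (fun m => ‖x (n + m) - x n‖) atTop (nhds ‖α - x n‖) := by
        have h := (tendsto_add_atTop_iff_nat n).2 hα
        simp only [add_comm _ n] at h
        exact (h.sub_const _).norm
      exact le_of_tendsto' hlim (hdiff n)
    have e : remainder a α (n + 1) = rubanQ a (n + 1) * (α - x n) := by
      rw [remainder_eq ha0]
      simp only [hx, Rat.cast_div]
      have := hQ0 n
      field_simp
    rw [e, norm_mul, (norm_rubanQ ha n).1]
    refine (mul_le_mul_of_nonneg_left h1 (by positivity)).trans_eq ?_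
    rw [show 2 * n + 1 = n + (n + 1) by ring, pow_add _ n]
    field_simp
  have e : (rubanQ a (n + 1) : ℚ_[p]) * remainder a α n =
      rubanQ a n * remainder a α (n + 1) + (-1) ^ (n + 1) := by
    rw [remainder_eq ha0, remainder_eq ha0, ← hdet n]
    ring
  have hlt : ‖(rubanQ a n : ℚ_[p]) * remainder a α (n + 1)‖ < 1 := by
    rw [norm_mul]
    calc _ ≤ (p : ℝ) ^ n * ((p : ℝ) ^ (n + 1))⁻¹ :=
          mul_le_mul ((norm_rubanQ ha n).2.le.trans_eq (norm_rubanQ ha n).1) (hle n)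
            (norm_nonneg _) (by positivity)
      _ = (p : ℝ)⁻¹ := by rw [pow_succ]; field_simp
      _ < 1 := inv_lt_one_of_one_lt₀ hp
  have h1 : ‖(rubanQ a (n + 1) : ℚ_[p]) * remainder a α n‖ = 1 := by
    have h2 : ‖((-1) ^ (n + 1) : ℚ_[p])‖ = 1 := by simp
    rw [e, IsUltrametricDist.norm_add_eq_max_of_norm_ne_norm (by rw [h2]; exact hlt.ne), h2,
      max_eq_right hlt.le]
  rw [norm_mul, (norm_rubanQ ha n).1] at h1
  exact eq_inv_of_mul_eq_one_right h1

end Convergents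

section TameRemainder

variable {K : Type*} [Field K] [NumberField K]

theorem exists_natCast_mul_isIntegral (r : K) : ∃ m : ℕ, m ≠ 0 ∧ IsIntegral ℤ (m * r : K) := by
  obtain ⟨m, hm0, hm⟩ := exists_integral_multiples ℤ ℚ ({r} : Finset K)
  refine ⟨m.natAbs, Int.natAbs_ne_zero.2 hm0, ?_⟩
  have h := hm r (Finset.mem_singleton_self r)
  rw [zsmul_eq_mul] at h
  rcases Int.natAbs_eq m with h' | h'
  · rw [h'] at h
    simpa using h
  · rw [h'] at h
    simpa using h.neg

theorem exists_norm_le (r : K) : ∃ A : ℝ, 1 ≤ A ∧ ∀ σ : K →+* ℂ, ‖σ r‖ ≤ A := by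
  refine ⟨1 + ∑ σ : K →+* ℂ, ‖σ r‖, by simpa using Finset.sum_nonneg fun _ _ => norm_nonneg _,
    fun σ => ?_⟩
  have := Finset.single_le_sum (f := fun σ : K →+* ℂ => ‖σ r‖) (fun _ _ => norm_nonneg _)
    (Finset.mem_univ σ)
  exact this.trans (by simp)

theorem tame_pow (r : K) : Tame fun k => r ^ 9 ^ k := by
  obtain ⟨q, hq0, hq⟩ := exists_natCast_mul_isIntegral r
  obtain ⟨A, hA, hr⟩ := exists_norm_le r
  refine ⟨q, hq0, A, hA, fun k => ?_, fun k σ => ?_⟩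
  · rw [← mul_pow]
    exact hq.pow _
  · rw [map_pow, norm_pow]
    exact pow_le_pow_left₀ (norm_nonneg _) (hr σ) _

theorem Tame.add_mul {z w : ℕ → K} (hz : Tame z) (hw : Tame w) (r : K) :
    Tame fun k => z k + r * w k := by
  obtain ⟨q₁, hq₁, A₁, hA₁, hz⟩ := hz
  obtain ⟨q₂, hq₂, A₂, hA₂, hw⟩ := hw
  obtain ⟨m, hm0, hm⟩ := exists_natCast_mul_isIntegral r
  obtain ⟨R, hR, hr⟩ := exists_norm_le r
  refine ⟨q₁ * q₂ * m, by positivity, 2 * (A₁ + R * A₂), by nlinarith, fun k => ?_, fun k σ => ?_⟩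
  · have h9 : 9 ^ k = (9 ^ k - 1) + 1 := (Nat.sub_add_cancel (Nat.one_le_pow _ _ (by norm_num))).symm
    have hN (n : ℕ) : IsIntegral ℤ (n : K) := isIntegral_natCast (R := ℤ) n
    have e : ((q₁ * q₂ * m : ℕ) : K) ^ 9 ^ k * (z k + r * w k) =
        (q₂ : K) ^ 9 ^ k * (m : K) ^ 9 ^ k * ((q₁ : K) ^ 9 ^ k * z k) +
        (q₁ : K) ^ 9 ^ k * (m : K) ^ (9 ^ k - 1) * (m * r) * ((q₂ : K) ^ 9 ^ k * w k) := by
      have hm' : (m : K) ^ 9 ^ k = (m : K) ^ (9 ^ k - 1) * m := by rw [← pow_succ, ← h9]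
      push_cast
      rw [mul_pow, mul_pow, hm']
      ring
    rw [e]
    exact ((((hN _).pow _).mul ((hN _).pow _)).mul (hz.isIntegral k)).add
      (((((hN _).pow _).mul ((hN _).pow _)).mul hm).mul (hw.isIntegral k))
  · have h9 : 1 ≤ 9 ^ k := Nat.one_le_pow _ _ (by norm_num)
    have h0 : 0 ≤ R * A₂ := by positivity
    have h1 := hz.norm_le k σ
    have h2 := hw.norm_le k σ
    rw [map_add, map_mul]
    refine (norm_add_le _ _).trans ?_
    rw [norm_mul]
    calc ‖σ (z k)‖ + ‖σ r‖ * ‖σ (w k)‖ ≤ A₁ ^ 9 ^ k + R ^ 9 ^ k * A₂ ^ 9 ^ k := by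
          refine add_le_add h1 (mul_le_mul ((hr σ).trans ?_) h2 (norm_nonneg _) (by positivity))
          exact le_self_pow₀ hR (by omega)
      _ ≤ (A₁ + R * A₂) ^ 9 ^ k + (A₁ + R * A₂) ^ 9 ^ k := by
          rw [← mul_pow]
          gcongr <;> linarith
      _ = 2 * (A₁ + R * A₂) ^ 9 ^ k := by ring
      _ ≤ 2 ^ 9 ^ k * (A₁ + R * A₂) ^ 9 ^ k := by
          refine mul_le_mul_of_nonneg_right (le_self_pow₀ (by norm_num) (by omega)) (by positivity)
      _ = _ := (mul_pow _ _ _).symm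

variable {p : ℕ} {a : ℕ → ℚ}

theorem isIntegral_remainder (ha : ∀ n, 1 ≤ n → ∃ z : ℤ, (p : ℚ) * a n = z) {x : K} {m : ℕ}
    (hm : IsIntegral ℤ (m * x : K)) (n : ℕ) :
    IsIntegral ℤ ((m : K) * (p : K) ^ n * remainder a x n) := by
  have hN (n : ℕ) : IsIntegral ℤ (n : K) := isIntegral_natCast (R := ℤ) n
  induction n using Nat.twoStepInduction with
  | zero => simpa [remainder] using (hN m).neg
  | one =>
    rw [remainder, pow_one, mul_right_comm]
    exact hm.mul (hN p)
  | more n h₁ h₂ =>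
    obtain ⟨z, hz⟩ := ha (n + 1) (Nat.le_add_left 1 n)
    have hz' : (p : K) * (a (n + 1) : K) = z := by
      have := congrArg (Rat.cast : ℚ → K) hz
      push_cast at this
      exact this
    have e : (m : K) * (p : K) ^ (n + 2) * remainder a x (n + 2) =
        z * (m * (p : K) ^ (n + 1) * remainder a x (n + 1)) +
          (p : K) ^ 2 * (m * (p : K) ^ n * remainder a x n) := by
      rw [remainder, ← hz']
      ring
    rw [e]
    exact ((isIntegral_intCast (R := ℤ) z).mul h₂).add (((hN p).pow 2).mul h₁)

theorem norm_remainder_le (ha : ∀ n, 1 ≤ n → |a n| ≤ p) {x : K} {A : ℝ} (hA : 1 ≤ A)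
    {σ : K →+* ℂ} (hx : ‖σ x‖ ≤ A) (n : ℕ) : ‖σ (remainder a x n)‖ ≤ A * (p + 1) ^ n := by
  have hp : (0 : ℝ) ≤ p := Nat.cast_nonneg p
  induction n using Nat.twoStepInduction with
  | zero => simpa [remainder] using hA
  | one =>
    rw [remainder, pow_one]
    nlinarith
  | more n h₁ h₂ =>
    have h : ‖((a (n + 1) : ℚ) : ℂ)‖ ≤ p := by
      have := ha (n + 1) (Nat.le_add_left 1 n)
      rw [← Complex.ofReal_ratCast, Complex.norm_real, Real.norm_eq_abs]
      exact_mod_cast this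
    rw [remainder, map_add, map_mul, map_ratCast]
    refine (norm_add_le _ _).trans ?_
    rw [norm_mul]
    calc _ ≤ p * (A * (p + 1) ^ (n + 1)) + A * (p + 1) ^ n := by gcongr
      _ ≤ p * (A * (p + 1) ^ (n + 1)) + A * (p + 1) ^ (n + 1) := by
        gcongr
        · linarith
        · exact Nat.le_succ n
      _ = A * (p + 1) ^ (n + 2) := by ring

theorem tame_remainder (hp : p ≠ 0) (ha : ∀ n, 1 ≤ n → ∃ z : ℤ, (p : ℚ) * a n = z)
    (ha' : ∀ n, 1 ≤ n → |a n| ≤ p) (x : K) {t : ℕ → ℕ} (ht : ∀ k, t k ≤ 9 ^ k) :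
    Tame fun k => remainder a x (t k) := by
  obtain ⟨m, hm0, hm⟩ := exists_natCast_mul_isIntegral x
  obtain ⟨A, hA, hx⟩ := exists_norm_le x
  have hp0 : (0 : ℝ) ≤ p := Nat.cast_nonneg p
  refine ⟨m * p, by positivity, A * (p + 1), by nlinarith, fun k => ?_, fun k σ => ?_⟩
  · have h9 : 9 ^ k = (9 ^ k - 1) + 1 := (Nat.sub_add_cancel (Nat.one_le_pow _ _ (by norm_num))).symm
    have hN (n : ℕ) : IsIntegral ℤ (n : K) := isIntegral_natCast (R := ℤ) n
    have e : ((m * p : ℕ) : K) ^ 9 ^ k * remainder a x (t k) =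
        (m : K) ^ (9 ^ k - 1) * (p : K) ^ (9 ^ k - t k) *
          (m * (p : K) ^ t k * remainder a x (t k)) := by
      have hm' : (m : K) ^ 9 ^ k = (m : K) ^ (9 ^ k - 1) * m := by rw [← pow_succ, ← h9]
      have hp' : (p : K) ^ 9 ^ k = (p : K) ^ (9 ^ k - t k) * (p : K) ^ t k := by
        rw [← pow_add, Nat.sub_add_cancel (ht k)]
      push_cast
      rw [mul_pow, hm', hp']
      ring
    rw [e]
    exact (((hN _).pow _).mul ((hN _).pow _)).mul (isIntegral_remainder ha hm _)
  · refine (norm_remainder_le ha' hA (hx σ) _).trans ?_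
    rw [mul_pow]
    have h9 : 1 ≤ 9 ^ k := Nat.one_le_pow _ _ (by norm_num)
    gcongr
    · exact le_self_pow₀ hA (by omega)
    · linarith
    · exact ht k

end TameRemainder

section Blocks

theorem eq_pow_mul_of_step {K : Type*} [Field K] {f : ℕ → K} {r : K} {m M : ℕ} (hM : m ≤ M)
    (h : ∀ i, m ≤ i → i < M → f (i + 1) = r * f i) : f M = r ^ (M - m) * f m := by
  induction M, hM using Nat.le_induction with
  | base => simp
  | succ M hM ih =>
    rw [h M hM M.lt_succ_self, ih fun i h₁ h₂ => h i h₁ (h₂.trans M.lt_succ_self),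
      Nat.succ_sub hM, pow_succ]
    ring

variable {K : Type*} [Field K] [CharZero K] {p : ℕ} {a : ℕ → ℚ} {x l m : K}

theorem remainder_even_block (hp : p ≠ 0)
    (han : ∀ n, 1 ≤ n →
      a n = if Even (Nat.log 3 n) then (p : ℚ) - (p : ℚ)⁻¹ else (p : ℚ)⁻¹) (k : ℕ) :
    (p : K) ^ (2 * 9 ^ k) * (remainder a x (3 * 9 ^ k) - p * remainder a x (3 * 9 ^ k - 1)) =
        remainder a x (9 ^ k) - p * remainder a x (9 ^ k - 1) ∧
      remainder a x (3 * 9 ^ k) + (p : K)⁻¹ * remainder a x (3 * 9 ^ k - 1) =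
        (p : K) ^ (2 * 9 ^ k) *
          (remainder a x (9 ^ k) + (p : K)⁻¹ * remainder a x (9 ^ k - 1)) := by
  have h9 : 1 ≤ 9 ^ k := Nat.one_le_pow _ _ (by norm_num)
  have hp' : (p : K) ≠ 0 := Nat.cast_ne_zero.2 hp
  have hstep (i : ℕ) (h₁ : 9 ^ k - 1 ≤ i) (h₂ : i < 3 * 9 ^ k - 1) :
      remainder a x (i + 2) =
        ((p : K) - (p : K)⁻¹) * remainder a x (i + 1) + remainder a x i := by
    have hlog : Nat.log 3 (i + 1) = 2 * k := by
      have e : 9 ^ k = 3 ^ (2 * k) := by rw [pow_mul]; norm_num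
      refine Nat.log_eq_of_pow_le_of_lt_pow ?_ ?_
      · rw [← e]; omega
      · rw [pow_succ, ← e]; omega
    rw [remainder, han _ (Nat.le_add_left 1 i), hlog, if_pos (even_two_mul k)]
    push_cast
    rfl
  have e₁ : 3 * 9 ^ k - 1 + 1 = 3 * 9 ^ k := by omega
  have e₂ : 9 ^ k - 1 + 1 = 9 ^ k := by omega
  have e₃ : 3 * 9 ^ k - 1 - (9 ^ k - 1) = 2 * 9 ^ k := by omega
  have hle : 9 ^ k - 1 ≤ 3 * 9 ^ k - 1 := by omega
  constructor
  · have h := eq_pow_mul_of_step (f := fun i => remainder a x (i + 1) - p * remainder a x i)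
      (r := -(p : K)⁻¹) hle fun i h₁ h₂ => by
        simp only [add_assoc, Nat.reduceAdd]
        rw [hstep i h₁ h₂]
        field_simp
        ring
    simp only [e₁, e₂, e₃] at h
    rw [h, (even_two_mul _).neg_pow, inv_pow, mul_inv_cancel_left₀ (pow_ne_zero _ hp')]
  · have h := eq_pow_mul_of_step
      (f := fun i => remainder a x (i + 1) + (p : K)⁻¹ * remainder a x i)
      (r := (p : K)) hle fun i h₁ h₂ => by
        simp only [add_assoc, Nat.reduceAdd]
        rw [hstep i h₁ h₂]
        field_simp
        ring
    simpa only [e₁, e₂, e₃] using h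

theorem remainder_odd_block
    (han : ∀ n, 1 ≤ n →
      a n = if Even (Nat.log 3 n) then (p : ℚ) - (p : ℚ)⁻¹ else (p : ℚ)⁻¹)
    (hl : l = (p : K)⁻¹ + m) (hlm : l * m = 1) (k : ℕ) :
    remainder a x (9 ^ (k + 1)) + m * remainder a x (9 ^ (k + 1) - 1) =
        l ^ (6 * 9 ^ k) *
          (remainder a x (3 * 9 ^ k) + m * remainder a x (3 * 9 ^ k - 1)) ∧
      remainder a x (9 ^ (k + 1)) - l * remainder a x (9 ^ (k + 1) - 1) =
        m ^ (6 * 9 ^ k) *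
          (remainder a x (3 * 9 ^ k) - l * remainder a x (3 * 9 ^ k - 1)) := by
  have h9 : 1 ≤ 9 ^ k := Nat.one_le_pow _ _ (by norm_num)
  have h9' : 9 ^ (k + 1) = 9 * 9 ^ k := pow_succ' _ _
  have hstep (i : ℕ) (h₁ : 3 * 9 ^ k - 1 ≤ i) (h₂ : i < 9 ^ (k + 1) - 1) :
      remainder a x (i + 2) = (l - m) * remainder a x (i + 1) + remainder a x i := by
    have hlog : Nat.log 3 (i + 1) = 2 * k + 1 := by
      have e : 9 ^ k = 3 ^ (2 * k) := by rw [pow_mul]; norm_num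
      refine Nat.log_eq_of_pow_le_of_lt_pow ?_ ?_
      · rw [pow_succ, ← e]; omega
      · rw [pow_succ, pow_succ, ← e]; omega
    rw [remainder, han _ (Nat.le_add_left 1 i), hlog,
      if_neg (Nat.not_even_iff_odd.2 (odd_two_mul_add_one k)), hl, add_sub_cancel_right]
    push_cast
    rfl
  have e₁ : 3 * 9 ^ k - 1 + 1 = 3 * 9 ^ k := by omega
  have e₂ : 9 ^ (k + 1) - 1 + 1 = 9 ^ (k + 1) := by omega
  have e₃ : 9 ^ (k + 1) - 1 - (3 * 9 ^ k - 1) = 6 * 9 ^ k := by omega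
  have hle : 3 * 9 ^ k - 1 ≤ 9 ^ (k + 1) - 1 := by omega
  constructor
  · have h := eq_pow_mul_of_step (f := fun i => remainder a x (i + 1) + m * remainder a x i)
      (r := l) hle fun i h₁ h₂ => by
        simp only [add_assoc, Nat.reduceAdd]
        rw [hstep i h₁ h₂]
        linear_combination -remainder a x i * hlm
    simpa only [e₁, e₂, e₃] using h
  · have h := eq_pow_mul_of_step (f := fun i => remainder a x (i + 1) - l * remainder a x i)
      (r := -m) hle fun i h₁ h₂ => by
        simp only [add_assoc, Nat.reduceAdd]
        rw [hstep i h₁ h₂]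
        linear_combination -remainder a x i * hlm
    simp only [e₁, e₂, e₃] at h
    rwa [((show Even 6 by decide).mul_right _).neg_pow] at h

theorem remainder_relation (hp : p ≠ 0)
    (han : ∀ n, 1 ≤ n →
      a n = if Even (Nat.log 3 n) then (p : ℚ) - (p : ℚ)⁻¹ else (p : ℚ)⁻¹)
    (hl : l = (p : K)⁻¹ + m) (hlm : l * m = 1) {c s : K} (hc : c * (m - (p : K)⁻¹) = p + m)
    (hs : s * (l + (p : K)⁻¹) = l - p) {A B : ℕ → K}
    (hA : ∀ k, A k = remainder a x (9 ^ k) + -p * remainder a x (9 ^ k - 1))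
    (hB : ∀ k, B k = remainder a x (9 ^ k) + (p : K)⁻¹ * remainder a x (9 ^ k - 1))
    (hB0 : ∀ k, B k ≠ 0) (k : ℕ) :
    (A k / B k - c * ((p : K) ^ 4) ^ 9 ^ k) * (A (k + 1) / B (k + 1) - s) =
      (m ^ 12) ^ 9 ^ k * (A k / B k - s * ((p : K) ^ 4) ^ 9 ^ k) *
        (A (k + 1) / B (k + 1) - c) := by
  obtain ⟨h₁, h₂⟩ := remainder_even_block (K := K) (x := x) hp han k
  obtain ⟨h₃, h₄⟩ := remainder_odd_block (x := x) han hl hlm k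
  set E := remainder a x (3 * 9 ^ k)
  set E' := remainder a x (3 * 9 ^ k - 1)
  set F := remainder a x (9 ^ (k + 1))
  set F' := remainder a x (9 ^ (k + 1) - 1)
  have hA0 : A k = (p : K) ^ (2 * 9 ^ k) * (E - p * E') := by rw [hA, h₁]; ring
  have hB1 : (p : K) ^ (2 * 9 ^ k) * B k = E + (p : K)⁻¹ * E' := by rw [hB, h₂]
  have hξ : ((p : K) ^ 4) ^ 9 ^ k = (p : K) ^ (2 * 9 ^ k) * (p : K) ^ (2 * 9 ^ k) := by
    rw [← pow_mul, ← pow_add]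
    ring
  have hυ : (m ^ 12) ^ 9 ^ k * l ^ (6 * 9 ^ k) = m ^ (6 * 9 ^ k) := by
    rw [← pow_mul, show 12 * 9 ^ k = 6 * 9 ^ k + 6 * 9 ^ k by ring, pow_add, mul_assoc, ← mul_pow,
      mul_comm m l, hlm, one_pow, mul_one]
  have key (r : K) : A k - r * ((p : K) ^ 4) ^ 9 ^ k * B k =
      (p : K) ^ (2 * 9 ^ k) * ((E - p * E') - r * (E + (p : K)⁻¹ * E')) := by
    rw [hA0, ← hB1, hξ]
    ring
  have h₅ : A (k + 1) - c * B (k + 1) =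
      l ^ (6 * 9 ^ k) * ((E - p * E') - c * (E + (p : K)⁻¹ * E')) := by
    have e (y z : K) : (y - p * z) - c * (y + (p : K)⁻¹ * z) = (1 - c) * (y + m * z) := by
      linear_combination z * hc
    rw [e, mul_left_comm, ← h₃, ← e, hA, hB]
    ring
  have h₆ : A (k + 1) - s * B (k + 1) =
      m ^ (6 * 9 ^ k) * ((E - p * E') - s * (E + (p : K)⁻¹ * E')) := by
    have e (y z : K) : (y - p * z) - s * (y + (p : K)⁻¹ * z) = (1 - s) * (y - l * z) := by
      linear_combination -z * hs
    rw [e, mul_left_comm, ← h₄, ← e, hA, hB]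
    ring
  have hb := hB0 k
  have hb' := hB0 (k + 1)
  have e₁ (r : K) : A k / B k - r * ((p : K) ^ 4) ^ 9 ^ k =
      (A k - r * ((p : K) ^ 4) ^ 9 ^ k * B k) / B k := by field_simp
  have e₂ (r : K) : A (k + 1) / B (k + 1) - r = (A (k + 1) - r * B (k + 1)) / B (k + 1) := by
    field_simp
  rw [e₁, e₁, e₂, e₂, key, key, h₅, h₆, ← hυ]
  ring

end Blocks

section NumberField

theorem pow_twelve_ne_one {K : Type*} [Field K] [NumberField K] {p : ℕ} (hp : 2 ≤ p) {ν : K}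
    (hν : (p : K) ^ 2 * ν ^ 2 + ν = 1) : ν ^ 12 ≠ 1 := by
  intro h
  obtain ⟨σ⟩ : Nonempty (K →+* ℂ) := inferInstance
  have h₁ : ‖σ ν‖ = 1 := by
    refine (pow_eq_one_iff_of_nonneg (norm_nonneg _) (by norm_num : 12 ≠ 0)).1 ?_
    rw [← norm_pow, ← map_pow, h, map_one, norm_one]
  have h₂ : (p : ℂ) ^ 2 * σ ν ^ 2 = 1 - σ ν := by
    have := congrArg σ hν
    simp only [map_add, map_mul, map_pow, map_natCast, map_one] at this
    exact eq_sub_of_add_eq this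
  have h₃ : (p : ℝ) ^ 2 ≤ 2 := by
    have := congrArg norm h₂
    rw [norm_mul, norm_pow, norm_pow, h₁, Complex.norm_natCast, one_pow, mul_one] at this
    rw [this]
    refine (norm_sub_le _ _).trans ?_
    rw [h₁, norm_one]
    norm_num
  have : (2 : ℝ) ≤ p := by exact_mod_cast hp
  nlinarith

variable {p : ℕ} [Fact p.Prime] {a : ℕ → ℚ}

theorem norm_remainder_add (ha0 : a 0 = 0) (ha : ∀ n, 1 ≤ n → ‖(a n : ℚ_[p])‖ = p)
    {α : ℚ_[p]} (hα : IsRubanValue p a α) (n : ℕ) :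
    ‖remainder a α (n + 1) + (p : ℚ_[p])⁻¹ * remainder a α n‖ = p * ((p : ℝ) ^ n)⁻¹ := by
  have hp : (1 : ℝ) < p := by exact_mod_cast (Fact.out : p.Prime).one_lt
  have h₁ : ‖(p : ℚ_[p])⁻¹ * remainder a α n‖ = p * ((p : ℝ) ^ n)⁻¹ := by
    rw [norm_mul, norm_inv, Padic.norm_p, inv_inv, norm_remainder ha0 ha hα]
  have h₂ : ‖remainder a α (n + 1)‖ < ‖(p : ℚ_[p])⁻¹ * remainder a α n‖ := by
    rw [h₁, norm_remainder ha0 ha hα, pow_succ, mul_inv, mul_comm]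
    gcongr
    exact (inv_lt_one_of_one_lt₀ hp).trans hp
  rw [IsUltrametricDist.norm_add_eq_max_of_norm_ne_norm h₂.ne, max_eq_right h₂.le, h₁]

theorem norm_remainder_sub_le (ha0 : a 0 = 0) (ha : ∀ n, 1 ≤ n → ‖(a n : ℚ_[p])‖ = p)
    {α : ℚ_[p]} (hα : IsRubanValue p a α) (n : ℕ) :
    ‖remainder a α (n + 1) - p * remainder a α n‖ ≤ ((p : ℝ) ^ (n + 1))⁻¹ := by
  rw [sub_eq_add_neg]
  refine (IsUltrametricDist.norm_add_le_max _ _).trans (max_le ?_ ?_)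
  · rw [norm_remainder ha0 ha hα]
  · rw [norm_neg, norm_mul, Padic.norm_p, norm_remainder ha0 ha hα, pow_succ, mul_inv, mul_comm]

theorem norm_partialQuotient
    (han : ∀ n, 1 ≤ n →
      a n = if Even (Nat.log 3 n) then (p : ℚ) - (p : ℚ)⁻¹ else (p : ℚ)⁻¹) {n : ℕ} (hn : 1 ≤ n) :
    ‖(a n : ℚ_[p])‖ = p := by
  have hp : (1 : ℝ) < p := by exact_mod_cast (Fact.out : p.Prime).one_lt
  have h : ‖((p : ℚ_[p])⁻¹)‖ = p := by rw [norm_inv, Padic.norm_p, inv_inv]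
  rw [han n hn]
  split_ifs
  · push_cast
    rw [sub_eq_add_neg, IsUltrametricDist.norm_add_eq_max_of_norm_ne_norm, norm_neg, h,
      Padic.norm_p, max_eq_right ((inv_lt_one_of_one_lt₀ hp).trans hp).le]
    rw [norm_neg, h, Padic.norm_p]
    exact ((inv_lt_one_of_one_lt₀ hp).trans hp).ne
  · push_cast
    exact h

theorem natCast_mul_partialQuotient
    (han : ∀ n, 1 ≤ n →
      a n = if Even (Nat.log 3 n) then (p : ℚ) - (p : ℚ)⁻¹ else (p : ℚ)⁻¹) {n : ℕ} (hn : 1 ≤ n) :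
    ∃ z : ℤ, (p : ℚ) * a n = z := by
  have hp : (p : ℚ) ≠ 0 := Nat.cast_ne_zero.2 (Fact.out : p.Prime).ne_zero
  rw [han n hn]
  split_ifs
  · refine ⟨(p : ℤ) ^ 2 - 1, ?_⟩
    push_cast
    field_simp
  · exact ⟨1, by simp [hp]⟩

theorem partialQuotient_mem_Ico
    (han : ∀ n, 1 ≤ n →
      a n = if Even (Nat.log 3 n) then (p : ℚ) - (p : ℚ)⁻¹ else (p : ℚ)⁻¹) {n : ℕ} (hn : 1 ≤ n) :
    a n ∈ Set.Ico 0 (p : ℚ) := by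
  have hp : (1 : ℚ) < p := by exact_mod_cast (Fact.out : p.Prime).one_lt
  have h₀ : 0 < (p : ℚ)⁻¹ := inv_pos.2 (by linarith)
  have h₁ : (p : ℚ)⁻¹ < 1 := inv_lt_one_of_one_lt₀ hp
  rw [han n hn]
  split_ifs <;> constructor <;> linarith

theorem false_of_isRubanValue {K : Type*} [Field K] [NumberField K] (ι : K →+* ℚ_[p]) {x ν : K}
    (hν : (p : K) ^ 2 * ν ^ 2 + ν = 1) (hν1 : ‖ι ν - 1‖ < ‖(p : ℚ_[p])‖) (ha0 : a 0 = 0)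
    (han : ∀ n, 1 ≤ n →
      a n = if Even (Nat.log 3 n) then (p : ℚ) - (p : ℚ)⁻¹ else (p : ℚ)⁻¹)
    (hα : IsRubanValue p a (ι x)) : False := by
  have hprime : p.Prime := Fact.out
  have hp : (1 : ℝ) < p := by exact_mod_cast hprime.one_lt
  have hpinv : (p : ℝ)⁻¹ < 1 := inv_lt_one_of_one_lt₀ hp
  have hpK : (p : K) ≠ 0 := Nat.cast_ne_zero.2 hprime.ne_zero
  have hnp : ‖(p : ℚ_[p])‖ = (p : ℝ)⁻¹ := Padic.norm_p
  have hnp' : ‖(p : ℚ_[p])⁻¹‖ = p := by rw [norm_inv, hnp, inv_inv]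
  have ha := fun n (hn : 1 ≤ n) => norm_partialQuotient (p := p) han hn
  have hadd {y z : ℚ_[p]} (h : ‖y‖ < ‖z‖) : ‖z + y‖ = ‖z‖ := by
    rw [IsUltrametricDist.norm_add_eq_max_of_norm_ne_norm h.ne', max_eq_left h.le]
  have hmax {y z : ℚ_[p]} {r : ℝ} (hy : ‖y‖ ≤ r) (hz : ‖z‖ ≤ r) : ‖y + z‖ ≤ r :=
    (IsUltrametricDist.norm_add_le_max _ _).trans (max_le hy hz)
  have hιν : ‖ι ν‖ = 1 := norm_eq_one_of_norm_sub_one_lt (by rw [hnp] at hν1; linarith)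
  have hν' : ν ≠ -1 := by
    rintro rfl
    have h : (p : K) ^ 2 = 2 := by linear_combination hν
    have h' : p ^ 2 = 2 := by exact_mod_cast h
    nlinarith [hprime.two_le]
  obtain ⟨m, hm⟩ : ∃ m : K, m = p * ν := ⟨_, rfl⟩
  obtain ⟨l, hl⟩ : ∃ l : K, l = (p : K)⁻¹ + m := ⟨_, rfl⟩
  have hlm : l * m = 1 := by
    rw [hl, hm]
    field_simp
    linear_combination hν
  have hnm : ‖ι m‖ = (p : ℝ)⁻¹ := by rw [hm, map_mul, map_natCast, norm_mul, hnp, hιν, mul_one]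
  have hltp : (p : ℝ)⁻¹ < p := hpinv.trans hp
  have hnl : ‖ι l‖ = p := by
    rw [hl, map_add, map_inv₀, map_natCast, hadd (by rw [hnm, hnp']; exact hltp), hnp']
  have hnd : ‖ι (m - (p : K)⁻¹)‖ = p := by
    rw [map_sub, map_inv₀, map_natCast, norm_sub_rev, sub_eq_add_neg,
      hadd (by rw [norm_neg, hnm, hnp']; exact hltp), hnp']
  have hne {y : K} (h : ‖ι y‖ = p) : y ≠ 0 := by
    rintro rfl
    rw [map_zero, norm_zero] at h
    linarith
  have hd0 : l + (p : K)⁻¹ ≠ 0 := by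
    intro h
    apply hν'
    have h' : 2 + (p : K) ^ 2 * ν = 0 := by
      rw [hl, hm] at h
      field_simp at h
      linear_combination h
    linear_combination ν * h' - hν
  have hnn : ‖ι (l - p)‖ = p := by
    rw [map_sub, map_natCast, sub_eq_add_neg, hadd (by rw [norm_neg, hnl, hnp]; exact hltp), hnl]
  obtain ⟨c, hc⟩ : ∃ c : K, c = (p + m) / (m - (p : K)⁻¹) := ⟨_, rfl⟩
  obtain ⟨s, hs⟩ : ∃ s : K, s = (l - p) / (l + (p : K)⁻¹) := ⟨_, rfl⟩
  have hc0 : c ≠ 0 := by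
    rw [hc]
    refine div_ne_zero (fun h => hν' ?_) (hne hnd)
    rw [hm] at h
    have : (p : K) * (1 + ν) = 0 := by linear_combination h
    rcases mul_eq_zero.1 this with h' | h'
    · exact absurd h' hpK
    · linear_combination h'
  have hs0 : s ≠ 0 := by
    rw [hs]
    exact div_ne_zero (hne hnn) hd0
  have hnc : ‖ι c‖ < 1 := by
    rw [hc, map_div₀, norm_div, hnd, div_lt_one (by linarith), map_add, map_natCast]
    exact (hmax hnp.le hnm.le).trans_lt hltp
  have hns : 1 ≤ ‖ι s‖ := by
    rw [hs, map_div₀, norm_div, hnn, one_le_div (norm_pos_iff.2 ((map_ne_zero ι).2 hd0)), map_add,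
      map_inv₀, map_natCast]
    exact hmax hnl.le hnp'.le
  have hcs (n : ℕ) (hn : n ≠ 0) : (s / c) ^ n ≠ 1 := by
    intro h
    rw [div_pow, div_eq_one_iff_eq (pow_ne_zero _ hc0)] at h
    have h₁ := congrArg (fun y => ‖ι y‖) h
    simp only [map_pow, norm_pow] at h₁
    have h₂ := pow_lt_one₀ (norm_nonneg (ι c)) hnc hn
    have h₃ := one_le_pow₀ hns (n := n)
    linarith
  obtain ⟨A, hA⟩ : ∃ A : ℕ → K,
    A = fun k => remainder a x (9 ^ k) + -p * remainder a x (9 ^ k - 1) := ⟨_, rfl⟩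
  obtain ⟨B, hB⟩ : ∃ B : ℕ → K,
    B = fun k => remainder a x (9 ^ k) + (p : K)⁻¹ * remainder a x (9 ^ k - 1) := ⟨_, rfl⟩
  have hBn (n : ℕ) (hn : 1 ≤ n) :
      ‖ι (remainder a x n + (p : K)⁻¹ * remainder a x (n - 1))‖ = p * ((p : ℝ) ^ (n - 1))⁻¹ := by
    obtain ⟨n, rfl⟩ := Nat.exists_eq_add_of_le' hn
    rw [Nat.add_sub_cancel, ← norm_remainder_add ha0 ha hα]
    simp [map_remainder]
  have hAn (n : ℕ) (hn : 1 ≤ n) :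
      ‖ι (remainder a x n - p * remainder a x (n - 1))‖ ≤ p * ((p : ℝ) ^ (n - 1))⁻¹ := by
    obtain ⟨n, rfl⟩ := Nat.exists_eq_add_of_le' hn
    have h := norm_remainder_sub_le ha0 ha hα n
    simp only [map_sub, map_mul, map_remainder, map_natCast, Nat.add_sub_cancel]
    refine h.trans ?_
    rw [pow_succ, mul_inv, mul_comm]
    gcongr
  have h9 (k : ℕ) : 1 ≤ 9 ^ k := Nat.one_le_pow _ _ (by norm_num)
  have hB0 (k : ℕ) : B k ≠ 0 := by
    intro h
    have h' := hBn (9 ^ k) (h9 k)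
    rw [hB] at h
    simp only at h
    rw [h, map_zero, norm_zero] at h'
    have : 0 < p * ((p : ℝ) ^ (9 ^ k - 1))⁻¹ := by positivity
    linarith
  have hAB (k : ℕ) : ‖ι (A k / B k)‖ ≤ 1 * ‖ι ((p : K) ^ 4)‖ ^ 9 ^ k := by
    obtain ⟨h₁, h₂⟩ := remainder_even_block (K := K) (x := x) hprime.ne_zero han k
    have h3 : 1 ≤ 3 * 9 ^ k := by have := h9 k; omega
    have hpow : (p : K) ^ (2 * 9 ^ k) ≠ 0 := pow_ne_zero _ hpK
    have e : A k / B k = ((p : K) ^ 4) ^ 9 ^ k *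
        ((remainder a x (3 * 9 ^ k) - p * remainder a x (3 * 9 ^ k - 1)) /
          (remainder a x (3 * 9 ^ k) + (p : K)⁻¹ * remainder a x (3 * 9 ^ k - 1))) := by
      have e₁ : A k = (p : K) ^ (2 * 9 ^ k) *
          (remainder a x (3 * 9 ^ k) - p * remainder a x (3 * 9 ^ k - 1)) := by
        rw [h₁, hA]
        ring
      have e₂ : ((p : K) ^ 4) ^ 9 ^ k = (p : K) ^ (2 * 9 ^ k) * (p : K) ^ (2 * 9 ^ k) := by
        rw [← pow_mul, ← pow_add]
        ring
      have e₃ : remainder a x (9 ^ k) + (p : K)⁻¹ * remainder a x (9 ^ k - 1) = B k := by rw [hB]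
      have := hB0 k
      rw [h₂, e₁, e₂, e₃]
      field_simp
    rw [e, map_mul, norm_mul, map_pow ι _ (9 ^ k), norm_pow, one_mul]
    refine mul_le_of_le_one_right (by positivity) ?_
    rw [map_div₀, norm_div, hBn _ h3]
    exact div_le_one_of_le₀ (hAn _ h3) (by positivity)
  have hξ : ‖ι ((p : K) ^ 4)‖ < 1 := by
    rw [map_pow, map_natCast, norm_pow, hnp]
    exact pow_lt_one₀ (by positivity) hpinv (by norm_num)
  have hz := fun n (hn : 1 ≤ n) => natCast_mul_partialQuotient (p := p) han hn
  have hle (n : ℕ) (hn : 1 ≤ n) : |a n| ≤ p := by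
    have := partialQuotient_mem_Ico (p := p) han hn
    rw [abs_of_nonneg this.1]
    exact this.2.le
  refine false_of_tame ι (c := c) (s := s) (ξ := (p : K) ^ 4) (υ := m ^ 12) (η := ν ^ 12)
    (a := A) (b := B) (B := 1) (ε := 1) hc0 hs0 hcs (pow_ne_zero _ hpK) hξ (by rw [hm]; ring) ?_
    (pow_twelve_ne_one hprime.two_le hν) hB0 hAB
    (remainder_relation (K := K) (x := x) hprime.ne_zero han hl hlm
      (by rw [hc, div_mul_cancel₀ _ (hne hnd)]) (by rw [hs, div_mul_cancel₀ _ hd0])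
      (fun k => by rw [hA]) (fun k => by rw [hB]) hB0)
    one_pos (fun k => ?_) (tame_pow _) (tame_pow _) ?_ ?_
  · rw [map_pow]
    exact (norm_pow_sub_one_le (hν1.le.trans (hnp.trans_le hpinv.le)) 12).trans_lt hν1
  · have hu : ‖ι (A (k + 1) / B (k + 1))‖ < 1 := by
      refine (hAB (k + 1)).trans_lt ?_
      rw [one_mul]
      exact pow_lt_one₀ (norm_nonneg _) hξ (by positivity)
    have hy : ‖ι ((m ^ 12) ^ 9 ^ k)‖ < 1 := by
      rw [← pow_mul, map_pow, norm_pow, hnm]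
      exact pow_lt_one₀ (by positivity) hpinv (by positivity)
    have hlt {y z : ℚ_[p]} (hy : ‖y‖ < 1) (hz : ‖z‖ < 1) : ‖y - z‖ < 1 := by
      rw [sub_eq_add_neg]
      exact (IsUltrametricDist.norm_add_le_max _ _).trans_lt (max_lt hy (by rwa [norm_neg]))
    have h : ‖ι (A (k + 1) / B (k + 1)) - ι ((m ^ 12) ^ 9 ^ k) * (ι (A (k + 1) / B (k + 1)) - ι c)‖
        < 1 := by
      refine hlt hu ?_
      rw [norm_mul]
      exact mul_lt_one_of_nonneg_of_lt_one_left (norm_nonneg _) hy (hlt hu hnc).le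
    rw [map_sub, map_mul, map_sub, map_sub, sub_right_comm, norm_sub_rev, sub_eq_add_neg, hadd]
    · exact hns
    · rw [norm_neg]
      exact h.trans_le hns
  · rw [hA]
    exact (tame_remainder hprime.ne_zero hz hle x fun k => le_rfl).add_mul
      (tame_remainder hprime.ne_zero hz hle x fun k => Nat.sub_le _ _) _
  · rw [hB]
    exact (tame_remainder hprime.ne_zero hz hle x fun k => le_rfl).add_mul
      (tame_remainder hprime.ne_zero hz hle x fun k => Nat.sub_le _ _) _

end NumberField

section Transcendence

variable {p : ℕ} [Fact p.Prime] {a : ℕ → ℚ}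

theorem partialQuotient_mem_Sp'
    (han : ∀ n, 1 ≤ n →
      a n = if Even (Nat.log 3 n) then (p : ℚ) - (p : ℚ)⁻¹ else (p : ℚ)⁻¹) {n : ℕ} (hn : 1 ≤ n) :
    a n ∈ Sp' p := by
  obtain ⟨z, hz⟩ := natCast_mul_partialQuotient (p := p) han hn
  have h := partialQuotient_mem_Ico (p := p) han hn
  refine ⟨⟨⟨1, z, by rw [pow_one, mul_comm, hz]⟩, h.1, h.2⟩, ?_⟩
  have h' := norm_partialQuotient (p := p) han hn
  rw [Padic.eq_padicNorm] at h'
  exact_mod_cast h'.ge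

theorem exists_root_near_one (p : ℕ) [Fact p.Prime] :
    ∃ ν : ℚ_[p], (p : ℚ_[p]) ^ 2 * ν ^ 2 + ν = 1 ∧ ‖ν - 1‖ < ‖(p : ℚ_[p])‖ := by
  have hp : (1 : ℝ) < p := by exact_mod_cast (Fact.out : p.Prime).one_lt
  have hpinv : (p : ℝ)⁻¹ < 1 := inv_lt_one_of_one_lt₀ hp
  have hp0 : (0 : ℝ) < (p : ℝ)⁻¹ := by positivity
  have hnp : ‖(p : ℤ_[p])‖ = (p : ℝ)⁻¹ := PadicInt.norm_p
  let F : ℤ_[p][X] := C ((p : ℤ_[p]) ^ 2) * X ^ 2 + X - 1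
  have h₁ : F.aeval (1 : ℤ_[p]) = (p : ℤ_[p]) ^ 2 := by simp [F]
  have h₂ : ‖F.derivative.aeval (1 : ℤ_[p])‖ = 1 := by
    have e : F.derivative.aeval (1 : ℤ_[p]) = (p : ℤ_[p]) ^ 2 * 2 + 1 := by
      simp [F, -map_pow, -map_natCast, one_add_one_eq_two]
    have h : ‖(p : ℤ_[p]) ^ 2 * 2‖ < 1 := by
      rw [norm_mul, norm_pow, hnp]
      exact mul_lt_one_of_nonneg_of_lt_one_left (by positivity)
        (pow_lt_one₀ hp0.le hpinv two_ne_zero) (PadicInt.norm_le_one _)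
    rw [e, IsUltrametricDist.norm_add_eq_max_of_norm_ne_norm (by rw [norm_one]; exact h.ne),
      norm_one, max_eq_right h.le]
  obtain ⟨z, hz, -⟩ := hensels_lemma (F := F) (a := (1 : ℤ_[p])) (by
    rw [h₁, h₂, norm_pow, hnp, one_pow]
    exact pow_lt_one₀ hp0.le hpinv two_ne_zero)
  have hz' : (p : ℤ_[p]) ^ 2 * z ^ 2 + z = 1 := by
    simp only [F, map_sub, map_add, map_mul, map_pow, aeval_X, aeval_C, map_one,
      Algebra.algebraMap_self, RingHom.id_apply] at hz
    linear_combination hz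
  have hzQ : (p : ℚ_[p]) ^ 2 * (z : ℚ_[p]) ^ 2 + z = 1 := by
    exact_mod_cast congrArg (Subtype.val : ℤ_[p] → ℚ_[p]) hz'
  refine ⟨z, hzQ, ?_⟩
  rw [show (z : ℚ_[p]) - 1 = -((p : ℚ_[p]) ^ 2 * (z : ℚ_[p]) ^ 2) by linear_combination hzQ,
    norm_neg, norm_mul, norm_pow, norm_pow, Padic.norm_p]
  have hz1 : ‖(z : ℚ_[p])‖ ≤ 1 := PadicInt.norm_le_one z
  calc (p : ℝ)⁻¹ ^ 2 * ‖(z : ℚ_[p])‖ ^ 2 ≤ (p : ℝ)⁻¹ ^ 2 * 1 :=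
        mul_le_mul_of_nonneg_left (pow_le_one₀ (norm_nonneg _) hz1) (by positivity)
    _ < (p : ℝ)⁻¹ := by nlinarith

theorem transcendental_of_isRubanValue (ha0 : a 0 = 0)
    (han : ∀ n, 1 ≤ n →
      a n = if Even (Nat.log 3 n) then (p : ℚ) - (p : ℚ)⁻¹ else (p : ℚ)⁻¹)
    {α : ℚ_[p]} (hα : IsRubanValue p a α) : Transcendental ℚ α := by
  intro hα'
  obtain ⟨ν, hν, hν1⟩ := exists_root_near_one p
  have hν' : IsAlgebraic ℚ ν := by
    refine ⟨C ((p : ℚ) ^ 2) * X ^ 2 + X - 1, fun h => ?_, ?_⟩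
    · simpa using congrArg (Polynomial.eval 0) h
    · simp [hν]
  let L : IntermediateField ℚ ℚ_[p] := IntermediateField.adjoin ℚ {α, ν}
  have hfin : FiniteDimensional ℚ L :=
    IntermediateField.finiteDimensional_adjoin (by
      rintro y (rfl | rfl)
      · exact hα'.isIntegral
      · exact hν'.isIntegral)
  have : NumberField L := { to_charZero := inferInstance, to_finiteDimensional := hfin }
  have hαL : α ∈ L := IntermediateField.subset_adjoin ℚ _ (by simp)
  have hνL : ν ∈ L := IntermediateField.subset_adjoin ℚ _ (by simp)
  exact false_of_isRubanValue (K := L) (algebraMap L ℚ_[p]) (x := ⟨α, hαL⟩) (ν := ⟨ν, hνL⟩)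
    (Subtype.ext (by simpa using hν)) hν1 ha0 han hα

end Transcendence

end RubanMahler

/-- **Example (1).** The Ruban continued fraction
`[0, \overline{p-p⁻¹}^{2·3⁰}, \overline{p⁻¹}^{2·3¹}, \overline{p-p⁻¹}^{2·3²}, …]`, whose
`n`-th partial quotient (for `n ≥ 1`) is `p - p⁻¹` when `⌊log₃ n⌋` is even and `p⁻¹`
when `⌊log₃ n⌋` is odd, has all partial quotients in `S'_p` and transcendental value. -/
theorem ruban_explicit_example_transcendental
    (p : ℕ) [Fact p.Prime]
    (a : ℕ → ℚ) (ha0 : a 0 = 0)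
    (han : ∀ n, 1 ≤ n →
      a n = if Even (Nat.log 3 n) then (p : ℚ) - (p : ℚ)⁻¹ else (p : ℚ)⁻¹)
    (α : ℚ_[p]) (hα : IsRubanValue p a α) :
    (∀ n, 1 ≤ n → a n ∈ Sp' p) ∧ Transcendental ℚ α :=
  ⟨fun _ hn => RubanMahler.partialQuotient_mem_Sp' han hn,
    RubanMahler.transcendental_of_isRubanValue ha0 han hα⟩
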